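/- arXiv:2312.01819 — 2 statements merged into one kernel-verified Lean document; each statement's English description precedes it below -/
import Mathlib

section
/- Let β₀ be the unique real root of 9x³ − 12x² + 29x − 10 = 0 (β₀ ≈ 0.38921378). For every α ∈ [β₀, 1.76] and every t ∈ (0, t_α), ∂³h_α(p(·,t))/∂t³ ≥ 0. -/
open MeasureTheory Real Filter
open scoped Classical

/-- The density `p(x,t)` of `X + √t Z` along the heat flow. -/
noncomputable def heatP (f : ℝ → ℝ) (t x : ℝ) : ℝ :=
  ∫ y : ℝ, f y * ((Real.sqrt (2 * Real.pi * t))⁻¹ * Real.exp (-(x - y) ^ 2 / (2 * t)))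

/-- `p_k(x,t) = ∂^k p / ∂x^k`. -/
noncomputable def pk (f : ℝ → ℝ) (k : ℕ) (t x : ℝ) : ℝ :=
  iteratedDeriv k (heatP f t) x

/-- `p̄_i = p_i / p`. -/
noncomputable def pbar (f : ℝ → ℝ) (i : ℕ) (t x : ℝ) : ℝ :=
  pk f i t x / heatP f t x

/-- The Rényi entropy `h_α(p(·,t))`, with the Shannon entropy at `α = 1`. -/
noncomputable def renyiEnt (f : ℝ → ℝ) (α t : ℝ) : ℝ :=
  if α = 1 then -∫ x : ℝ, heatP f t x * Real.log (heatP f t x)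
  else (1 - α)⁻¹ * Real.log (∫ x : ℝ, heatP f t x ^ α)

/-- Finiteness `|h_α(p(·,t))| < ∞` of the Rényi entropy at time `t`. -/
def renyiFinite (f : ℝ → ℝ) (α t : ℝ) : Prop :=
  if α = 1 then Integrable (fun x : ℝ => heatP f t x * Real.log (heatP f t x))
  else Integrable (fun x : ℝ => heatP f t x ^ α) ∧ 0 < ∫ x : ℝ, heatP f t x ^ α

/-- `t < t_α` where `t_α = sup { s > 0 : |h_α(p(·,s))| < ∞ }`. -/
def ltTalpha (f : ℝ → ℝ) (α t : ℝ) : Prop :=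
  ∃ s : ℝ, t < s ∧ 0 < s ∧ renyiFinite f α s

/-- The tilted expectation `E_α[g] = (∫ g p^α) / (∫ p^α)`. -/
noncomputable def Ea (f : ℝ → ℝ) (α t : ℝ) (g : ℝ → ℝ) : ℝ :=
  (∫ x : ℝ, g x * heatP f t x ^ α) / (∫ x : ℝ, heatP f t x ^ α)


structure HeatSetup (α : ℝ) (U : Set ℝ) (a b c d w : ℝ → ℝ → ℝ) (T : (ℝ → ℝ → ℝ) → Prop)
    (B : ℝ → ℝ) : Prop where
  isOpen : IsOpen U
  add : ∀ F G, T F → T G → T (fun s x => F s x + G s x)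
  mul : ∀ F G, T F → T G → T (fun s x => F s x * G s x)
  const : ∀ k : ℝ, T (fun _ _ => k)
  Ta : T a
  Tb : T b
  Tc : T c
  Td : T d
  dom : ∀ F, T F → ∃ C : ℝ, ∀ s ∈ U, ∀ x, |F s x| * w s x ≤ C * B x
  cont : ∀ F, T F → ∀ s ∈ U, Continuous (F s)
  wpos : ∀ s ∈ U, ∀ x, 0 < w s x
  wcont : ∀ s ∈ U, Continuous (w s)
  Bint : Integrable B
  ax : ∀ s ∈ U, ∀ x, HasDerivAt (a s) (b s x) x
  bx : ∀ s ∈ U, ∀ x, HasDerivAt (b s) (c s x) x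
  cx : ∀ s ∈ U, ∀ x, HasDerivAt (c s) (d s x) x
  wx : ∀ s ∈ U, ∀ x, HasDerivAt (w s) (α * a s x * w s x) x
  at' : ∀ s ∈ U, ∀ x, HasDerivAt (fun s => a s x) ((c s x + 2 * a s x * b s x) / 2) s
  bt : ∀ s ∈ U, ∀ x,
    HasDerivAt (fun s => b s x) ((d s x + 2 * b s x ^ 2 + 2 * a s x * c s x) / 2) s
  wt : ∀ s ∈ U, ∀ x, HasDerivAt (fun s => w s x) (α / 2 * (b s x + a s x ^ 2) * w s x) s

namespace HeatSetup

variable {α : ℝ} {U : Set ℝ} {a b c d w : ℝ → ℝ → ℝ} {T : (ℝ → ℝ → ℝ) → Prop} {B : ℝ → ℝ}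

theorem pow (h : HeatSetup α U a b c d w T B) (F : ℝ → ℝ → ℝ) (hF : T F) (n : ℕ) :
    T (fun s x => F s x ^ n) := by
  induction n with
  | zero => simpa using h.const 1
  | succ n ih => simpa [pow_succ] using h.mul _ _ ih hF

theorem integrable (h : HeatSetup α U a b c d w T B) {F : ℝ → ℝ → ℝ} (hF : T F) {s : ℝ}
    (hs : s ∈ U) : Integrable (fun x => F s x * w s x) := by
  obtain ⟨C, hC⟩ := h.dom F hF
  refine (h.Bint.const_mul C).mono' ((h.cont F hF s hs).mul (h.wcont s hs)).aestronglyMeasurable ?_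
  refine Eventually.of_forall fun x => ?_
  rw [norm_mul, Real.norm_eq_abs, Real.norm_eq_abs, abs_of_pos (h.wpos s hs x)]
  exact hC s hs x

theorem deriv_int (h : HeatSetup α U a b c d w T B) {F G : ℝ → ℝ → ℝ} (hF : T F) (hG : T G)
    (hd : ∀ s ∈ U, ∀ x, HasDerivAt (fun s => F s x * w s x) (G s x * w s x) s) {s : ℝ}
    (hs : s ∈ U) :
    HasDerivAt (fun s => ∫ x, F s x * w s x) (∫ x, G s x * w s x) s := by
  obtain ⟨C, hC⟩ := h.dom G hG
  refine (hasDerivAt_integral_of_dominated_loc_of_deriv_le (μ := volume)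
    (bound := fun x => C * B x) (F := fun s x => F s x * w s x) (F' := fun s x => G s x * w s x)
    (h.isOpen.mem_nhds hs) ?_ (h.integrable hF hs) (h.integrable hG hs).aestronglyMeasurable
    ?_ (h.Bint.const_mul C) ?_).2
  · filter_upwards [h.isOpen.mem_nhds hs] with r hr
    exact (h.integrable hF hr).aestronglyMeasurable
  · refine Eventually.of_forall fun x r hr => ?_
    rw [norm_mul, Real.norm_eq_abs, Real.norm_eq_abs, abs_of_pos (h.wpos r hr x)]
    exact hC r hr x
  · exact Eventually.of_forall fun x r hr => hd r hr x

theorem ibp (h : HeatSetup α U a b c d w T B) {F G : ℝ → ℝ → ℝ} (hF : T F) (hG : T G)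
    {s : ℝ} (hs : s ∈ U) (hd : ∀ x, HasDerivAt (F s) (G s x) x) :
    ∫ x, (G s x + α * a s x * F s x) * w s x = 0 := by
  have hT : T (fun s x => G s x + α * a s x * F s x) :=
    h.add _ _ hG (h.mul _ _ (h.mul _ _ (h.const α) h.Ta) hF)
  refine integral_eq_zero_of_hasDerivAt_of_integrable (f := fun x => F s x * w s x) ?_
    (h.integrable hT hs) (h.integrable hF hs)
  intro x
  exact ((hd x).mul (h.wx s hs x)).congr_deriv (by ring)

theorem I_pos (h : HeatSetup α U a b c d w T B) {s : ℝ} (hs : s ∈ U) : 0 < ∫ x, w s x := by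
  have hi : Integrable (w s) := by simpa using h.integrable (h.const 1) hs
  rw [integral_pos_iff_support_of_nonneg (fun x => (h.wpos s hs x).le) hi]
  have : Function.support (w s) = Set.univ := by
    ext x; simp [(h.wpos s hs x).ne']
  simp [this]

theorem ibp_eq (h : HeatSetup α U a b c d w T B) {F G H : ℝ → ℝ → ℝ} (hF : T F) (hG : T G)
    (hH : T H) {s : ℝ} (hs : s ∈ U) (hd : ∀ x, HasDerivAt (F s) (G s x) x) {E : ℝ → ℝ}
    (hE : ∀ x, E x = H s x - (G s x + α * a s x * F s x)) :
    ∫ x, E x * w s x = ∫ x, H s x * w s x := by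
  have h0 := h.ibp hF hG hs hd
  have hT : T (fun s x => G s x + α * a s x * F s x) :=
    h.add _ _ hG (h.mul _ _ (h.mul _ _ (h.const α) h.Ta) hF)
  simp_rw [hE, sub_mul]
  rw [integral_sub (h.integrable hH hs) (h.integrable hT hs), h0, sub_zero]

theorem I_deriv (h : HeatSetup α U a b c d w T B) {s : ℝ} (hs : s ∈ U) :
    HasDerivAt (fun s => ∫ x, w s x) (α * (1 - α) / 2 * ∫ x, a s x ^ 2 * w s x) s := by
  have hG : T (fun s x => α / 2 * (b s x + a s x ^ 2)) :=
    h.mul _ _ (h.const _) (h.add _ _ h.Tb (h.pow _ h.Ta 2))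
  have h1 := h.deriv_int (h.const 1) hG (fun s hs x => by simpa using h.wt s hs x) hs
  simp only [one_mul] at h1
  refine h1.congr_deriv ?_
  rw [← integral_const_mul]
  rw [h.ibp_eq (F := fun s x => -(α / 2) * a s x) (G := fun s x => -(α / 2) * b s x)
    (H := fun s x => α * (1 - α) / 2 * a s x ^ 2) ?_ ?_ ?_ hs ?_ ?_]
  · congr 1; ext x; ring
  · exact h.mul _ _ (h.const _) h.Ta
  · exact h.mul _ _ (h.const _) h.Tb
  · exact h.mul _ _ (h.const _) (h.pow _ h.Ta 2)
  · exact fun x => (h.ax s hs x).const_mul _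
  · intro x; ring

theorem J_deriv (h : HeatSetup α U a b c d w T B) {s : ℝ} (hs : s ∈ U) :
    HasDerivAt (fun s => ∫ x, a s x ^ 2 * w s x)
      (- ∫ x, (b s x ^ 2 + α * (1 - α) / 6 * a s x ^ 4) * w s x) s := by
  have hG : T (fun s x => a s x * (c s x + 2 * a s x * b s x) +
      α / 2 * (a s x ^ 2 * (b s x + a s x ^ 2))) := by
    repeat' first
        | exact h.Ta | exact h.Tb | exact h.Tc | exact h.Td | exact h.const _
        | apply h.pow | apply h.add | apply h.mul
  have h1 := h.deriv_int (h.pow _ h.Ta 2) hG (fun s hs x =>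
    (((h.at' s hs x).pow 2).mul (h.wt s hs x)).congr_deriv (by simp; ring)) hs
  refine h1.congr_deriv ?_
  rw [← integral_neg]
  rw [h.ibp_eq (F := fun s x => -1 * (a s x * b s x) + -((2 - α / 2) / 3) * a s x ^ 3)
    (G := fun s x => -1 * (b s x * b s x + a s x * c s x) +
      -((2 - α / 2) / 3) * (3 * a s x ^ 2 * b s x))
    (H := fun s x => -1 * (b s x ^ 2 + α * (1 - α) / 6 * a s x ^ 4)) ?_ ?_ ?_ hs ?_ ?_]
  · congr 1; ext x; ring
  · repeat' first
        | exact h.Ta | exact h.Tb | exact h.Tc | exact h.Td | exact h.const _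
        | apply h.pow | apply h.add | apply h.mul
  · repeat' first
        | exact h.Ta | exact h.Tb | exact h.Tc | exact h.Td | exact h.const _
        | apply h.pow | apply h.add | apply h.mul
  · repeat' first
        | exact h.Ta | exact h.Tb | exact h.Tc | exact h.Td | exact h.const _
        | apply h.pow | apply h.add | apply h.mul
  · intro x
    exact ((((h.ax s hs x).mul (h.bx s hs x)).const_mul (-1)).add
      (((h.ax s hs x).pow 3).const_mul (-((2 - α / 2) / 3)))).congr_deriv (by simp)
  · intro x; ring

/-- raw time derivative of `(b² + κ a⁴) w`, divided by `w` -/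
noncomputable def rawT (α : ℝ) (a b c d : ℝ → ℝ → ℝ) (s x : ℝ) : ℝ :=
  b s x * (d s x + 2 * b s x ^ 2 + 2 * a s x * c s x) +
    2 * (α * (1 - α) / 6) * (a s x ^ 3 * (c s x + 2 * a s x * b s x)) +
    α / 2 * ((b s x ^ 2 + α * (1 - α) / 6 * a s x ^ 4) * (b s x + a s x ^ 2))

theorem rawT_mem (h : HeatSetup α U a b c d w T B) : T (rawT α a b c d) := by
  unfold rawT
  repeat' first
        | exact h.Ta | exact h.Tb | exact h.Tc | exact h.Td | exact h.const _
        | apply h.pow | apply h.add | apply h.mul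

theorem K_deriv (h : HeatSetup α U a b c d w T B) {s : ℝ} (hs : s ∈ U) :
    HasDerivAt (fun s => ∫ x, (b s x ^ 2 + α * (1 - α) / 6 * a s x ^ 4) * w s x)
      (∫ x, rawT α a b c d s x * w s x) s := by
  refine h.deriv_int ?_ h.rawT_mem (fun s hs x => ?_) hs
  · repeat' first
        | exact h.Ta | exact h.Tb | exact h.Tc | exact h.Td | exact h.const _
        | apply h.pow | apply h.add | apply h.mul
  · exact ((((h.bt s hs x).pow 2).add (((h.at' s hs x).pow 4).const_mul
      (α * (1 - α) / 6))).mul (h.wt s hs x)).congr_deriv (by unfold rawT; simp; ring)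

noncomputable def certR (α μ n A B C : ℝ) : ℝ :=
  (C + (1 + α) * (A * B) + (2 - α + 3 * α ^ 2) / 12 * A ^ 3 +
      (3 / 2 * α * (α - 1) + n) / 2 * μ * A) ^ 2
    + (2 - α) * (9 * α ^ 3 - 12 * α ^ 2 + 29 * α - 10) / 720 * A ^ 6
    + (α ^ 2 * (α - 1) ^ 2 / 2 + α ^ 2 * n - (3 / 2 * α * (α - 1) + n) ^ 2 / 4) * μ ^ 2 * A ^ 2
    + n * μ * (B + α * μ) ^ 2
    + (α ^ 2 * (α - 1) ^ 2 / 4 - (3 / 2 * α * (α - 1) + n) * (α - 1) * (3 * α - 2) / 12) * μ * A ^ 4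

theorem cert (h : HeatSetup α U a b c d w T B) {s : ℝ} (hs : s ∈ U) (μ n : ℝ) :
    ∫ x, (-rawT α a b c d s x + 9 * (α * (1 - α) / 6) * μ *
      (b s x ^ 2 + α * (1 - α) / 6 * a s x ^ 4)
      + 18 * (α * (1 - α) / 6) ^ 2 * μ ^ 2 * a s x ^ 2) * w s x =
    ∫ x, (certR α μ n (a s x) (b s x) (c s x) + α ^ 2 * n * μ ^ 2 * (a s x ^ 2 + -μ)) * w s x := by
  obtain ⟨κ, hκ⟩ : ∃ κ, κ = α * (1 - α) / 6 := ⟨_, rfl⟩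
  obtain ⟨lam, hlam⟩ : ∃ lam, lam = (2 + α + α ^ 2) / 6 := ⟨_, rfl⟩
  obtain ⟨nu, hnu⟩ : ∃ nu, nu = (lam + 2 * κ - 3 / 2 * α * κ) / 5 := ⟨_, rfl⟩
  obtain ⟨ρ, hρ⟩ : ∃ ρ, ρ = 3 / 2 * α * (α - 1) + n := ⟨_, rfl⟩
  refine h.ibp_eq (F := fun s x => b s x * c s x + (2 + α / 2) * (a s x * b s x ^ 2) +
      lam * (a s x ^ 3 * b s x) + nu * a s x ^ 5 + ρ * μ * (a s x * b s x) +
      ρ / 3 * μ * a s x ^ 3 + 2 * α * n * μ ^ 2 * a s x)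
    (G := fun s x => (c s x * c s x + b s x * d s x) +
      (2 + α / 2) * (b s x * b s x ^ 2 + a s x * (2 * b s x * c s x)) +
      lam * (3 * a s x ^ 2 * b s x * b s x + a s x ^ 3 * c s x) + nu * (5 * a s x ^ 4 * b s x) +
      ρ * μ * (b s x * b s x + a s x * c s x) +
      ρ / 3 * μ * (3 * a s x ^ 2 * b s x) + 2 * α * n * μ ^ 2 * b s x)
    (H := fun s x => certR α μ n (a s x) (b s x) (c s x) + α ^ 2 * n * μ ^ 2 * (a s x ^ 2 + -μ))
    ?_ ?_ ?_ hs ?_ ?_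
  · repeat' first
        | exact h.Ta | exact h.Tb | exact h.Tc | exact h.Td | exact h.const _
        | apply h.pow | apply h.add | apply h.mul
  · repeat' first
        | exact h.Ta | exact h.Tb | exact h.Tc | exact h.Td | exact h.const _
        | apply h.pow | apply h.add | apply h.mul
  · unfold certR
    repeat' first
        | exact h.Ta | exact h.Tb | exact h.Tc | exact h.Td | exact h.const _
        | apply h.pow | apply h.add | apply h.mul
  · intro x
    have A := h.ax s hs x
    have B := h.bx s hs x
    have C := h.cx s hs x
    exact (((((((B.mul C).add ((A.mul (B.pow 2)).const_mul (2 + α / 2))).add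
      (((A.pow 3).mul B).const_mul lam)).add ((A.pow 5).const_mul nu)).add
      ((A.mul B).const_mul (ρ * μ))).add ((A.pow 3).const_mul (ρ / 3 * μ))).add
      (A.const_mul (2 * α * n * μ ^ 2))).congr_deriv (by simp)
  · intro x
    subst hρ hnu hlam hκ
    simp only [certR, rawT]
    ring

theorem main_ineq (h : HeatSetup α U a b c d w T B)
    (hα : 0 ≤ 9 * α ^ 3 - 12 * α ^ 2 + 29 * α - 10) (hα0 : 0 < α) (hα2 : α ≤ 1.76)
    {s : ℝ} (hs : s ∈ U) (μ : ℝ)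
    (hμ : μ = (∫ x, a s x ^ 2 * w s x) / ∫ x, w s x) :
    0 ≤ - (∫ x, rawT α a b c d s x * w s x) + 9 * (α * (1 - α) / 6) * μ *
      (∫ x, (b s x ^ 2 + α * (1 - α) / 6 * a s x ^ 4) * w s x)
      + 18 * (α * (1 - α) / 6) ^ 2 * μ ^ 2 * (∫ x, a s x ^ 2 * w s x) := by
  have hw := h.wpos s hs
  have hI := h.I_pos hs
  have hJ : 0 ≤ ∫ x, a s x ^ 2 * w s x :=
    integral_nonneg fun x => mul_nonneg (sq_nonneg _) (hw x).le
  have hμ0 : 0 ≤ μ := hμ ▸ div_nonneg hJ hI.le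
  have iJ := h.integrable (h.pow _ h.Ta 2) hs
  have iw : Integrable (w s) := by simpa using h.integrable (h.const 1) hs
  have iR := h.integrable h.rawT_mem hs
  have iK : Integrable (fun x => (b s x ^ 2 + α * (1 - α) / 6 * a s x ^ 4) * w s x) := by
    refine h.integrable (F := fun s x => b s x ^ 2 + α * (1 - α) / 6 * a s x ^ 4) ?_ hs
    repeat' first
        | exact h.Ta | exact h.Tb | exact h.Tc | exact h.Td | exact h.const _
        | apply h.pow | apply h.add | apply h.mul
  have hC : 0 ≤ (2 - α) * (9 * α ^ 3 - 12 * α ^ 2 + 29 * α - 10) / 720 := by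
    have : 0 ≤ 2 - α := by norm_num at hα2; linarith
    positivity
  have expand : ∀ ν : ℝ, ∫ x, (-rawT α a b c d s x + 9 * (α * (1 - α) / 6) * ν *
      (b s x ^ 2 + α * (1 - α) / 6 * a s x ^ 4)
      + 18 * (α * (1 - α) / 6) ^ 2 * ν ^ 2 * a s x ^ 2) * w s x =
      - (∫ x, rawT α a b c d s x * w s x) + 9 * (α * (1 - α) / 6) * ν *
      (∫ x, (b s x ^ 2 + α * (1 - α) / 6 * a s x ^ 4) * w s x)
      + 18 * (α * (1 - α) / 6) ^ 2 * ν ^ 2 * (∫ x, a s x ^ 2 * w s x) := by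
    intro ν
    rw [← integral_const_mul, ← integral_const_mul, ← integral_neg, ← integral_add,
      ← integral_add]
    · congr 1; ext x; ring
    · exact iR.neg.add (iK.const_mul _)
    · exact iJ.const_mul _
    · exact iR.neg
    · exact iK.const_mul _
  rcases le_total α 1 with h1 | h1
  · have e := (expand 0).symm.trans (h.cert hs 0 0)
    have hK : 0 ≤ ∫ x, (b s x ^ 2 + α * (1 - α) / 6 * a s x ^ 4) * w s x := by
      refine integral_nonneg fun x => mul_nonneg ?_ (hw x).le
      have : 0 ≤ 1 - α := by linarith
      positivity
    have hR : 0 ≤ ∫ x, (certR α 0 0 (a s x) (b s x) (c s x) +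
        α ^ 2 * 0 * 0 ^ 2 * (a s x ^ 2 + -0)) * w s x := by
      refine integral_nonneg fun x => mul_nonneg ?_ (hw x).le
      simp only [certR]
      have := mul_nonneg hC (by positivity : 0 ≤ a s x ^ 6)
      simp only [mul_zero, zero_mul, add_zero, ne_eq, OfNat.ofNat_ne_zero, not_false_eq_true,
        zero_pow]
      exact add_nonneg (sq_nonneg _) this
    rw [← e] at hR
    have h1' : 0 ≤ 1 - α := by linarith
    have t1 : 0 ≤ 9 * (α * (1 - α) / 6) * μ *
      (∫ x, (b s x ^ 2 + α * (1 - α) / 6 * a s x ^ 4) * w s x) := by positivity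
    have t2 : 0 ≤ 18 * (α * (1 - α) / 6) ^ 2 * μ ^ 2 * (∫ x, a s x ^ 2 * w s x) := by positivity
    simp only [mul_zero, zero_mul, add_zero, ne_eq, OfNat.ofNat_ne_zero, not_false_eq_true,
        zero_pow] at hR
    linarith
  · have hd : 0 < 3 * α - 2 := by linarith
    obtain ⟨e, he⟩ : ∃ e, e = (3 * α - 2)⁻¹ := ⟨_, rfl⟩
    have he0 : 0 < e := he ▸ inv_pos.2 hd
    have hq : e * (3 * α - 2) = 1 := by rw [he]; exact inv_mul_cancel₀ hd.ne'
    obtain ⟨n, hn⟩ : ∃ n, n = 3 * α ^ 2 * (α - 1) * e - 3 / 2 * α * (α - 1) := ⟨_, rfl⟩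
    have h1' : 0 ≤ α - 1 := by linarith
    have h2 : 0 ≤ 2 - α := by norm_num at hα2; linarith
    have hn0 : 0 ≤ n := by
      have : n = 3 / 2 * α * (α - 1) * (2 - α) * e := by
        rw [hn]; linear_combination (3 / 2 * α * (α - 1)) * hq
      rw [this]; positivity
    have hG : 0 ≤ α ^ 2 * (α - 1) ^ 2 / 2 + α ^ 2 * n - (3 / 2 * α * (α - 1) + n) ^ 2 / 4 := by
      have : α ^ 2 * (α - 1) ^ 2 / 2 + α ^ 2 * n - (3 / 2 * α * (α - 1) + n) ^ 2 / 4 =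
          α ^ 2 * (α - 1) * (-9 * α ^ 3 + 15 * α ^ 2 + 8 * α - 8) / 4 * e ^ 2 := by
        rw [hn]
        linear_combination (-(α ^ 2 * (α - 1) ^ 2 / 2 - 3 / 2 * α ^ 3 * (α - 1)) *
          (e * (3 * α - 2) + 1) - 3 * α ^ 4 * (α - 1) * e) * hq
      rw [this]
      have : 0 ≤ -9 * α ^ 3 + 15 * α ^ 2 + 8 * α - 8 := by
        norm_num at hα2
        nlinarith [mul_nonneg h1' (sub_nonneg.2 hα2), mul_nonneg hα0.le (mul_nonneg h1' (sub_nonneg.2 hα2))]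
      positivity
    have hE : α ^ 2 * (α - 1) ^ 2 / 4 -
        (3 / 2 * α * (α - 1) + n) * (α - 1) * (3 * α - 2) / 12 = 0 := by
      rw [hn]; linear_combination -(α ^ 2 * (α - 1) ^ 2 / 4) * hq
    have e := (expand μ).symm.trans (h.cert hs μ n)
    rw [e]
    have iS : Integrable (fun x => certR α μ n (a s x) (b s x) (c s x) * w s x) := by
      refine h.integrable (F := fun s x => certR α μ n (a s x) (b s x) (c s x)) ?_ hs
      unfold certR
      repeat' first
        | exact h.Ta | exact h.Tb | exact h.Tc | exact h.Td | exact h.const _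
        | apply h.pow | apply h.add | apply h.mul
    have split : ∫ x, (certR α μ n (a s x) (b s x) (c s x) +
        α ^ 2 * n * μ ^ 2 * (a s x ^ 2 + -μ)) * w s x =
        (∫ x, certR α μ n (a s x) (b s x) (c s x) * w s x) +
        α ^ 2 * n * μ ^ 2 * ((∫ x, a s x ^ 2 * w s x) + -μ * ∫ x, w s x) := by
      rw [← integral_const_mul, ← integral_add iJ (iw.const_mul _), ← integral_const_mul,
        ← integral_add iS]
      · congr 1; ext x; ring
      · exact (iJ.add (iw.const_mul _)).const_mul _
    have z : (∫ x, a s x ^ 2 * w s x) + -μ * ∫ x, w s x = 0 := by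
      rw [hμ]; field_simp; ring
    rw [split, z, mul_zero, add_zero]
    refine integral_nonneg fun x => mul_nonneg ?_ (hw x).le
    simp only [certR]
    rw [hE]
    have := mul_nonneg hC (by positivity : 0 ≤ a s x ^ 6)
    have := mul_nonneg hG (by positivity : 0 ≤ μ ^ 2 * a s x ^ 2)
    have := mul_nonneg (mul_nonneg hn0 hμ0) (sq_nonneg (b s x + α * μ))
    rw [zero_mul, zero_mul, add_zero]
    rw [← mul_assoc] at *
    refine add_nonneg (add_nonneg (add_nonneg (sq_nonneg _) ?_) ?_) ?_ <;> assumption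

theorem main (h : HeatSetup α U a b c d w T B)
    (hα : 0 ≤ 9 * α ^ 3 - 12 * α ^ 2 + 29 * α - 10) (hα0 : 0 < α) (hα2 : α ≤ 1.76)
    {s : ℝ} (hs : s ∈ U) :
    0 ≤ iteratedDeriv 2 (fun s => (∫ x, a s x ^ 2 * w s x) / ∫ x, w s x) s := by
  have d1 : ∀ r ∈ U, HasDerivAt (fun s => (∫ x, a s x ^ 2 * w s x) / ∫ x, w s x)
      (- (∫ x, (b r x ^ 2 + α * (1 - α) / 6 * a r x ^ 4) * w r x) / (∫ x, w r x)
        - α * (1 - α) / 2 * ((∫ x, a r x ^ 2 * w r x) / ∫ x, w r x) ^ 2) r := by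
    intro r hr
    have hI := (h.I_pos hr).ne'
    refine ((h.J_deriv hr).div (h.I_deriv hr) hI).congr_deriv ?_
    generalize (∫ x, w r x) = I at *
    generalize (∫ x, a r x ^ 2 * w r x) = J
    generalize (∫ x, (b r x ^ 2 + α * (1 - α) / 6 * a r x ^ 4) * w r x) = K
    field_simp
  have hI := (h.I_pos hs).ne'
  have d2 := (((h.K_deriv hs).neg.div (h.I_deriv hs) hI).sub
    (((d1 s hs).pow 2).const_mul (α * (1 - α) / 2))).congr_of_eventuallyEq
    (f₁ := deriv (fun s => (∫ x, a s x ^ 2 * w s x) / ∫ x, w s x)) (by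
      filter_upwards [h.isOpen.mem_nhds hs] with r hr
      exact (d1 r hr).deriv)
  rw [iteratedDeriv_succ', iteratedDeriv_one, d2.deriv]
  have key := h.main_ineq hα hα0 hα2 hs _ rfl
  have := div_nonneg key (h.I_pos hs).le
  refine this.trans_eq ?_
  simp only [Pi.neg_apply]
  generalize (∫ x, w s x) = I at *
  generalize (∫ x, a s x ^ 2 * w s x) = J
  generalize (∫ x, (b s x ^ 2 + α * (1 - α) / 6 * a s x ^ 4) * w s x) = K
  push_cast
  field_simp
  ring

end HeatSetup

/-- Gaussian kernel -/
noncomputable def gK (t z : ℝ) : ℝ := (Real.sqrt (2 * Real.pi * t))⁻¹ * Real.exp (-z ^ 2 / (2 * t))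

/-- Hermite factors: `∂_z^k gK = hk k * gK` for `k ≤ 4`. -/
noncomputable def hk : ℕ → ℝ → ℝ → ℝ
  | 0, _, _ => 1
  | 1, t, z => -z / t
  | 2, t, z => z ^ 2 / t ^ 2 - 1 / t
  | 3, t, z => -z ^ 3 / t ^ 3 + 3 * z / t ^ 2
  | 4, t, z => z ^ 4 / t ^ 4 - 6 * z ^ 2 / t ^ 3 + 3 / t ^ 2
  | _, _, _ => 0

noncomputable def KK (k : ℕ) (t z : ℝ) : ℝ := hk k t z * gK t z

noncomputable def PP (f : ℝ → ℝ) (k : ℕ) (t x : ℝ) : ℝ := ∫ y, f y * KK k t (x - y)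

theorem PP_zero (f : ℝ → ℝ) (t x : ℝ) : PP f 0 t x = heatP f t x := by
  simp [PP, heatP, KK, hk, gK]

theorem gK_pos {t : ℝ} (ht : 0 < t) (z : ℝ) : 0 < gK t z := by
  unfold gK; positivity

theorem gK_dz {t : ℝ} (ht : 0 < t) (z : ℝ) : HasDerivAt (gK t) (-z / t * gK t z) z := by
  have h1 : HasDerivAt (fun z : ℝ => -z ^ 2 / (2 * t)) (-z / t) z := by
    refine (((hasDerivAt_id z).pow 2).neg.div_const (2 * t)).congr_deriv ?_
    simp; field_simp
  exact (h1.exp.const_mul (Real.sqrt (2 * Real.pi * t))⁻¹).congr_deriv (by unfold gK; ring)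

theorem gK_dt {t : ℝ} (ht : 0 < t) (z : ℝ) :
    HasDerivAt (fun t => gK t z) ((z ^ 2 / t ^ 2 - 1 / t) / 2 * gK t z) t := by
  have h1 : HasDerivAt (fun t : ℝ => -z ^ 2 / (2 * t)) (z ^ 2 / (2 * t ^ 2)) t := by
    refine (((hasDerivAt_id t).const_mul 2).inv (by simp; positivity)|>.const_mul
      (-z ^ 2)).congr_deriv ?_
    simp; field_simp; try ring
  have h0 : 2 * Real.pi * t ≠ 0 := by positivity
  have h2 : HasDerivAt (fun t : ℝ => (Real.sqrt (2 * Real.pi * t))⁻¹)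
      (-(1 / (2 * t)) * (Real.sqrt (2 * Real.pi * t))⁻¹) t := by
    have hs : Real.sqrt (2 * Real.pi * t) ≠ 0 := by positivity
    refine ((((hasDerivAt_id t).const_mul (2 * Real.pi)).sqrt h0).inv hs).congr_deriv ?_
    simp only [id, mul_one]
    have : Real.sqrt (2 * Real.pi * t) ^ 2 = 2 * Real.pi * t := Real.sq_sqrt (by positivity)
    rw [this]
    field_simp
  exact (h2.mul h1.exp).congr_deriv (by unfold gK; field_simp; ring)

theorem KK_dz {t : ℝ} (ht : 0 < t) (z : ℝ) {k : ℕ} (hk4 : k < 4) :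
    HasDerivAt (KK k t) (KK (k + 1) t z) z := by
  have hh : HasDerivAt (hk k t) (hk (k + 1) t z + z / t * hk k t z) z := by
    have i1 := hasDerivAt_id z
    interval_cases k
    · exact (hasDerivAt_const z (1 : ℝ)).congr_deriv (by simp [hk]; field_simp; ring)
    · exact (i1.neg.div_const t).congr_deriv (by simp [hk]; field_simp; ring)
    · exact (((i1.pow 2).div_const (t ^ 2)).sub_const (1 / t)).congr_deriv
        (by simp [hk]; field_simp; ring)
    · exact (((i1.pow 3).neg.div_const (t ^ 3)).add ((i1.const_mul 3).div_const (t ^ 2))).congr_deriv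
        (by simp [hk]; field_simp; ring)
  exact (hh.mul (gK_dz ht z)).congr_deriv (by unfold KK; ring)

theorem KK_dt {t : ℝ} (ht : 0 < t) (z : ℝ) {k : ℕ} (hk4 : k < 3) :
    HasDerivAt (fun t => KK k t z) (KK (k + 2) t z / 2) t := by
  have hh : HasDerivAt (fun t => hk k t z)
      (hk (k + 2) t z / 2 - (z ^ 2 / t ^ 2 - 1 / t) / 2 * hk k t z) t := by
    have i1 := hasDerivAt_inv ht.ne'
    have e1 : ∀ c : ℝ, ∀ n : ℕ, HasDerivAt (fun t : ℝ => c / t ^ n) (-(n * c) / t ^ (n + 1)) t := by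
      intro c n
      have := ((hasDerivAt_id t).pow n).inv (by simp; intro h; exact absurd h ht.ne')
      refine (this.const_mul c).congr_deriv ?_
      rcases n with _ | n
      · simp
      · simp; field_simp; try ring
    have e2 := e1 1 1
    have e3 := e1 (-z) 1
    simp only [pow_one] at e2 e3
    interval_cases k
    · exact (hasDerivAt_const t (1 : ℝ)).congr_deriv (by simp [hk])
    · exact e3.congr_deriv (by simp [hk]; field_simp; ring)
    · exact ((e1 (z ^ 2) 2).sub e2).congr_deriv
        (by simp [hk]; field_simp; ring)
  exact (hh.mul (gK_dt ht z)).congr_deriv (by unfold KK; ring)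

theorem hk_bound {t0 : ℝ} (ht0 : 0 < t0) :
    ∃ A : ℝ, 0 ≤ A ∧ ∀ k < 5, ∀ t, t0 < t → ∀ z, |hk k t z| ≤ A * (1 + z ^ 2) ^ 2 := by
  obtain ⟨τ, hτ⟩ : ∃ τ : ℝ, τ = 1 + 1 / t0 := ⟨_, rfl⟩
  have hτ1 : 1 ≤ τ := by rw [hτ]; have : 0 < 1 / t0 := by positivity
                         linarith
  refine ⟨10 * τ ^ 4, by positivity, fun k hk5 t ht z => ?_⟩
  have htp : 0 < t := ht0.trans ht
  obtain ⟨u, hu⟩ : ∃ u : ℝ, u = t⁻¹ := ⟨_, rfl⟩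
  have hu0 : 0 < u := by rw [hu]; positivity
  have huτ : u ≤ τ := by
    have : t⁻¹ ≤ t0⁻¹ := inv_anti₀ ht0 ht.le
    rw [hu, hτ, one_div]; linarith
  have p1 : u ≤ τ ^ 4 := huτ.trans (le_self_pow₀ hτ1 (by norm_num))
  have p2 : u ^ 2 ≤ τ ^ 4 := (pow_le_pow_left₀ hu0.le huτ 2).trans (pow_le_pow_right₀ hτ1 (by norm_num))
  have p3 : u ^ 3 ≤ τ ^ 4 := (pow_le_pow_left₀ hu0.le huτ 3).trans (pow_le_pow_right₀ hτ1 (by norm_num))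
  have p4 : u ^ 4 ≤ τ ^ 4 := pow_le_pow_left₀ hu0.le huτ 4
  have p0 : 1 ≤ τ ^ 4 := one_le_pow₀ hτ1
  obtain ⟨M, hM⟩ : ∃ M : ℝ, M = τ ^ 4 := ⟨_, rfl⟩
  obtain ⟨W, hW⟩ : ∃ W : ℝ, W = (1 + z ^ 2) ^ 2 := ⟨_, rfl⟩
  rw [← hM] at p0 p1 p2 p3 p4 ⊢
  rw [← hW]
  have hM0 : 0 ≤ M := by linarith
  have w0 : 1 ≤ W := by rw [hW]; nlinarith [sq_nonneg z]
  have w1 : |z| ≤ W := by rw [hW, ← sq_abs z]; nlinarith [sq_nonneg (|z|), sq_nonneg (|z| - 1), abs_nonneg z, sq_nonneg (|z|^2)]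
  have w2 : |z| ^ 2 ≤ W := by rw [hW, ← sq_abs z]; nlinarith [sq_nonneg (|z|), sq_nonneg (|z|^2)]
  have w3 : |z| ^ 3 ≤ W := by rw [hW, ← sq_abs z]; nlinarith [sq_nonneg (|z|), sq_nonneg (|z| ^ 2 - |z|), sq_nonneg (|z|^2)]
  have w4 : |z| ^ 4 ≤ W := by rw [hW, ← sq_abs z]; nlinarith [sq_nonneg (|z|)]
  have key : ∀ (c v : ℝ), 0 ≤ c → c ≤ W → 0 ≤ v → v ≤ M → c * v ≤ M * W := by
    intro c v h1 h2 h3 h4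
    rw [mul_comm M W]; exact mul_le_mul h2 h4 h3 (by linarith)
  have a0 : (0:ℝ) ≤ |z| := abs_nonneg z
  have MW : 0 ≤ M * W := by positivity
  interval_cases k
  · simp only [hk, abs_one]; nlinarith
  · have : hk 1 t z = -(z * u) := by simp only [hk, hu]; field_simp
    rw [this, abs_neg, abs_mul, abs_of_pos hu0]
    linarith [key |z| u a0 w1 hu0.le p1]
  · have : hk 2 t z = z ^ 2 * u ^ 2 - u := by simp only [hk, hu]; field_simp
    rw [this]
    refine (abs_sub _ _).trans ?_
    rw [abs_mul, abs_pow, abs_pow, abs_of_pos hu0]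
    linarith [key (|z| ^ 2) (u ^ 2) (by positivity) w2 (by positivity) p2,
      key 1 u zero_le_one w0 hu0.le p1]
  · have : hk 3 t z = 3 * (z * u ^ 2) - z ^ 3 * u ^ 3 := by simp only [hk, hu]; field_simp; ring
    rw [this]
    refine (abs_sub _ _).trans ?_
    simp only [abs_mul, abs_pow, abs_of_pos hu0]
    rw [abs_of_pos (by norm_num : (0:ℝ) < 3)]
    linarith [key (|z| ^ 3) (u ^ 3) (by positivity) w3 (by positivity) p3,
      key |z| (u ^ 2) a0 w1 (by positivity) p2]
  · have : hk 4 t z = z ^ 4 * u ^ 4 + 3 * u ^ 2 - 6 * (z ^ 2 * u ^ 3) := by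
      simp only [hk, hu]; field_simp; ring
    rw [this]
    refine (abs_sub _ _).trans ((add_le_add_left (abs_add_le _ _) _).trans ?_)
    simp only [abs_mul, abs_pow, abs_of_pos hu0]
    rw [abs_of_pos (by norm_num : (0:ℝ) < 3), abs_of_pos (by norm_num : (0:ℝ) < 6)]
    linarith [key (|z| ^ 4) (u ^ 4) (by positivity) w4 (by positivity) p4,
      key (|z| ^ 2) (u ^ 3) (by positivity) w2 (by positivity) p3,
      key 1 (u ^ 2) zero_le_one w0 (by positivity) p2]

/-- Uniform comparison of Hermite-weighted kernels with a later kernel. -/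
theorem hk_pow_bound {t0 t1 S : ℝ} (ht0 : 0 < t0) (ht01 : t0 < t1) (h1S : t1 < S) (q : ℕ) :
    ∃ C : ℝ, 0 ≤ C ∧ ∀ k < 5, ∀ t ∈ Set.Ioo t0 t1, ∀ z, |hk k t z| ^ q * gK t z ≤ C * gK S z := by
  obtain ⟨A, hA0, hA⟩ := hk_bound ht0
  have ht1 : 0 < t1 := ht0.trans ht01
  have hS : 0 < S := ht1.trans h1S
  obtain ⟨ε, hε⟩ : ∃ ε : ℝ, ε = 1 / (2 * t1) - 1 / (2 * S) := ⟨_, rfl⟩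
  have hε0 : 0 < ε := by
    rw [hε, sub_pos]; exact one_div_lt_one_div_of_lt (by positivity) (by linarith)
  obtain ⟨D, hD⟩ : ∃ D : ℝ, D = (2 * q).factorial / ε ^ (2 * q) * Real.exp ε := ⟨_, rfl⟩
  have hD0 : 0 ≤ D := by rw [hD]; positivity
  have hpow : ∀ z : ℝ, (1 + z ^ 2) ^ (2 * q) ≤ D * Real.exp (ε * z ^ 2) := by
    intro z
    have := Real.pow_div_factorial_le_exp (ε * (1 + z ^ 2)) (by positivity) (2 * q)
    rw [mul_add, mul_one, Real.exp_add, ← mul_one_add, mul_pow] at this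
    rw [hD]
    have hf : (0:ℝ) < (2 * q).factorial := by positivity
    rw [div_le_iff₀ hf] at this
    rw [div_mul_eq_mul_div, div_mul_eq_mul_div, le_div_iff₀ (by positivity)]
    linarith
  refine ⟨A ^ q * D * (Real.sqrt (2 * Real.pi * t0))⁻¹ * Real.sqrt (2 * Real.pi * S),
    by positivity, fun k hk5 t ht z => ?_⟩
  have htp : 0 < t := ht0.trans ht.1
  have s1 : |hk k t z| ^ q ≤ A ^ q * (D * Real.exp (ε * z ^ 2)) := by
    calc |hk k t z| ^ q ≤ (A * (1 + z ^ 2) ^ 2) ^ q :=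
          pow_le_pow_left₀ (abs_nonneg _) (hA k hk5 t ht.1 z) q
      _ = A ^ q * (1 + z ^ 2) ^ (2 * q) := by rw [mul_pow, ← pow_mul]
      _ ≤ _ := mul_le_mul_of_nonneg_left (hpow z) (by positivity)
  have s2 : gK t z ≤ (Real.sqrt (2 * Real.pi * t0))⁻¹ * Real.exp (-z ^ 2 / (2 * t1)) := by
    unfold gK
    refine mul_le_mul ?_ ?_ (Real.exp_pos _).le (by positivity)
    · refine inv_anti₀ (by positivity) (Real.sqrt_le_sqrt ?_)
      exact mul_le_mul_of_nonneg_left ht.1.le (by positivity)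
    · rw [Real.exp_le_exp, neg_div, neg_div, neg_le_neg_iff]
      exact div_le_div_of_nonneg_left (sq_nonneg z) (by positivity) (by linarith [ht.2])
  calc |hk k t z| ^ q * gK t z ≤ (A ^ q * (D * Real.exp (ε * z ^ 2))) *
        ((Real.sqrt (2 * Real.pi * t0))⁻¹ * Real.exp (-z ^ 2 / (2 * t1))) :=
        mul_le_mul s1 s2 (gK_pos htp z).le (by positivity)
    _ = A ^ q * D * (Real.sqrt (2 * Real.pi * t0))⁻¹ *
        (Real.exp (ε * z ^ 2) * Real.exp (-z ^ 2 / (2 * t1))) := by ring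
    _ = A ^ q * D * (Real.sqrt (2 * Real.pi * t0))⁻¹ * Real.exp (-z ^ 2 / (2 * S)) := by
        rw [← Real.exp_add]; congr 2; rw [hε]; field_simp; ring
    _ = _ := by
        unfold gK
        have : Real.sqrt (2 * Real.pi * S) ≠ 0 := by positivity
        field_simp

theorem gK_cont {t : ℝ} (ht : 0 < t) : Continuous (gK t) :=
  continuous_iff_continuousAt.2 fun z => (gK_dz ht z).continuousAt

theorem hk_cont (k : ℕ) (t : ℝ) : Continuous (hk k t) := by
  rcases k with _ | _ | _ | _ | _ | k <;> unfold hk <;> fun_prop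

theorem KK_cont (k : ℕ) {t : ℝ} (ht : 0 < t) : Continuous (KK k t) :=
  (hk_cont k t).mul (gK_cont ht)

theorem gK_le {t : ℝ} (ht : 0 < t) (z : ℝ) : gK t z ≤ (Real.sqrt (2 * Real.pi * t))⁻¹ := by
  unfold gK
  refine mul_le_of_le_one_right (by positivity) ?_
  rw [Real.exp_le_one_iff, neg_div]
  have : 0 ≤ z ^ 2 / (2 * t) := by positivity
  linarith

theorem KK_bdd {t0 t1 : ℝ} (ht0 : 0 < t0) (ht01 : t0 < t1) :
    ∃ C : ℝ, ∀ k < 5, ∀ t ∈ Set.Ioo t0 t1, ∀ z, |KK k t z| ≤ C := by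
  obtain ⟨C, hC0, hC⟩ := hk_pow_bound ht0 ht01 (lt_add_one t1) 1
  refine ⟨C * (Real.sqrt (2 * Real.pi * (t1 + 1)))⁻¹, fun k hk5 t ht z => ?_⟩
  have h1 : (0:ℝ) < t1 + 1 := by linarith
  have := hC k hk5 t ht z
  rw [KK, abs_mul, abs_of_pos (gK_pos (ht0.trans ht.1) z)]
  rw [pow_one] at this
  exact this.trans (mul_le_mul_of_nonneg_left (gK_le h1 z) hC0)

section P
variable {f : ℝ → ℝ}

theorem int_hk_pow (hf : Integrable f) {k q : ℕ} (hk5 : k < 5) {t : ℝ} (ht : 0 < t) (x : ℝ) :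
    Integrable (fun y => f y * (|hk k t (x - y)| ^ q * gK t (x - y))) := by
  obtain ⟨C, hC0, hC⟩ := hk_pow_bound (t0 := t / 2) (t1 := 2 * t) (S := 3 * t) (by linarith)
    (by linarith) (by linarith) q
  have hcont : Continuous (fun y => |hk k t (x - y)| ^ q * gK t (x - y)) :=
    (((hk_cont k t).comp (by fun_prop : Continuous fun y => x - y)).abs.pow q).mul
      ((gK_cont ht).comp (by fun_prop : Continuous fun y => x - y))
  refine hf.mul_bdd (c := C * (Real.sqrt (2 * Real.pi * (3 * t)))⁻¹) hcont.aestronglyMeasurable ?_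
  refine Eventually.of_forall fun y => ?_
  rw [Real.norm_eq_abs, abs_of_nonneg (mul_nonneg (by positivity) (gK_pos ht _).le)]
  exact (hC k hk5 t ⟨by linarith, by linarith⟩ _).trans
    (mul_le_mul_of_nonneg_left (gK_le (by linarith) _) hC0)

theorem int_KK (hf : Integrable f) {k : ℕ} (hk5 : k < 5) {t : ℝ} (ht : 0 < t) (x : ℝ) :
    Integrable (fun y => f y * KK k t (x - y)) := by
  obtain ⟨C, hC⟩ := KK_bdd (t0 := t / 2) (t1 := 2 * t) (by linarith) (by linarith)
  refine hf.mul_bdd (c := C) ((KK_cont k ht).comp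
    (by fun_prop : Continuous fun y => x - y)).aestronglyMeasurable ?_
  exact Eventually.of_forall fun y => hC k hk5 t ⟨by linarith, by linarith⟩ _

theorem PP_dx (hf : Integrable f) {k : ℕ} (hk4 : k < 4) {t : ℝ} (ht : 0 < t) (x : ℝ) :
    HasDerivAt (PP f k t) (PP f (k + 1) t x) x := by
  obtain ⟨C, hC⟩ := KK_bdd (t0 := t / 2) (t1 := 2 * t) (by linarith) (by linarith)
  refine (hasDerivAt_integral_of_dominated_loc_of_deriv_le (μ := volume)
    (bound := fun y => |f y| * C) (F := fun x y => f y * KK k t (x - y))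
    (F' := fun x y => f y * KK (k + 1) t (x - y)) (s := Set.univ) univ_mem ?_
    (int_KK hf (by omega) ht x) (int_KK hf (by omega) ht x).aestronglyMeasurable ?_
    (hf.abs.mul_const C) ?_).2
  · exact Eventually.of_forall fun x => (int_KK hf (by omega) ht x).aestronglyMeasurable
  · refine Eventually.of_forall fun y x _ => ?_
    rw [norm_mul, Real.norm_eq_abs, Real.norm_eq_abs]
    exact mul_le_mul_of_nonneg_left (hC (k + 1) (by omega) t ⟨by linarith, by linarith⟩ _)
      (abs_nonneg _)
  · refine Eventually.of_forall fun y x _ => ?_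
    have := (KK_dz ht (x - y) hk4).comp x ((hasDerivAt_id x).sub_const y)
    exact (this.const_mul (f y)).congr_deriv (by simp)

theorem PP_dt (hf : Integrable f) {k : ℕ} (hk4 : k < 3) {t : ℝ} (ht : 0 < t) (x : ℝ) :
    HasDerivAt (fun t => PP f k t x) (PP f (k + 2) t x / 2) t := by
  obtain ⟨C, hC⟩ := KK_bdd (t0 := t / 2) (t1 := 2 * t) (by linarith) (by linarith)
  have hU : Set.Ioo (t / 2) (2 * t) ∈ nhds t := Ioo_mem_nhds (by linarith) (by linarith)
  have := (hasDerivAt_integral_of_dominated_loc_of_deriv_le (μ := volume)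
    (bound := fun y => |f y| * C) (F := fun t y => f y * KK k t (x - y))
    (F' := fun t y => f y * (KK (k + 2) t (x - y) / 2)) hU ?_
    (int_KK hf (by omega) ht x) ?_ ?_
    (hf.abs.mul_const C) ?_).2
  · refine this.congr_deriv ?_
    rw [PP, ← integral_div]
    congr 1; ext y; ring
  · filter_upwards [hU] with s hs
    exact (int_KK hf (by omega) (by linarith [hs.1]) x).aestronglyMeasurable
  · have := ((int_KK hf (show k + 2 < 5 by omega) ht x).div_const 2).aestronglyMeasurable
    refine this.congr (Eventually.of_forall fun y => ?_)
    simp only; ring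
  · refine Eventually.of_forall fun y s hs => ?_
    rw [norm_mul, Real.norm_eq_abs, Real.norm_eq_abs]
    refine mul_le_mul_of_nonneg_left ?_ (abs_nonneg _)
    have := hC (k + 2) (by omega) s hs (x - y)
    rw [abs_div, abs_two]
    linarith [abs_nonneg (KK (k + 2) s (x - y))]
  · refine Eventually.of_forall fun y s hs => ?_
    exact (KK_dt (by linarith [hs.1]) (x - y) hk4).const_mul (f y)

theorem PP_pos (hf : Integrable f) (hf0 : ∀ x, 0 ≤ f x) (hf1 : (∫ x : ℝ, f x) = 1)
    {t : ℝ} (ht : 0 < t) (x : ℝ) : 0 < PP f 0 t x := by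
  unfold PP
  have hg : ∀ y, 0 < KK 0 t (x - y) := fun y => by simpa [KK, hk] using gK_pos ht (x - y)
  rw [integral_pos_iff_support_of_nonneg (fun y => mul_nonneg (hf0 y) (hg y).le)
    (int_KK hf (by norm_num) ht x)]
  have : Function.support (fun y => f y * KK 0 t (x - y)) = Function.support f := by
    ext y; simp [(hg y).ne']
  rw [this, ← integral_pos_iff_support_of_nonneg hf0 hf, hf1]
  exact one_pos

/-- ratio bounds -/
theorem ratio_bound (hf : Integrable f) (hf0 : ∀ x, 0 ≤ f x) (hf1 : (∫ x : ℝ, f x) = 1)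
    {t0 t1 S : ℝ} (ht0 : 0 < t0) (ht01 : t0 < t1) (h1S : t1 < S) (q : ℕ) :
    ∃ C : ℝ, 0 ≤ C ∧ ∀ k < 5, ∀ t ∈ Set.Ioo t0 t1, ∀ x,
      |PP f k t x / PP f 0 t x| ^ q ≤ C * (PP f 0 S x / PP f 0 t x) := by
  obtain ⟨C, hC0, hC⟩ := hk_pow_bound ht0 ht01 h1S q
  have hS : 0 < S := by linarith
  have hIntB : ∀ k < 5, ∀ t ∈ Set.Ioo t0 t1, ∀ x,
      ∫ y, f y * (|hk k t (x - y)| ^ q * gK t (x - y)) ≤ C * PP f 0 S x := by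
    intro k hk5 t ht x
    rw [PP, ← integral_const_mul]
    refine integral_mono (int_hk_pow hf hk5 (ht0.trans ht.1) x)
      ((int_KK hf (by norm_num) hS x).const_mul C) fun y => ?_
    simp only [KK, hk, one_mul]
    calc f y * (|hk k t (x - y)| ^ q * gK t (x - y)) ≤ f y * (C * gK S (x - y)) :=
          mul_le_mul_of_nonneg_left (hC k hk5 t ht _) (hf0 y)
      _ = _ := by ring
  rcases Nat.eq_zero_or_pos q with rfl | hq
  · refine ⟨C, hC0, fun k hk5 t ht x => ?_⟩
    have h := hIntB 0 (by norm_num) t ht x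
    have hp := PP_pos hf hf0 hf1 (ht0.trans ht.1) x
    rw [pow_zero, ← mul_div_assoc, le_div_iff₀ hp, one_mul]
    refine le_trans (le_of_eq ?_) h
    simp [PP, KK, hk]
  refine ⟨(1 + C) ^ q, by positivity, fun k hk5 t ht x => ?_⟩
  have htp := ht0.trans ht.1
  have hp := PP_pos hf hf0 hf1 htp x
  have hpS := PP_pos hf hf0 hf1 hS x
  have hR : 0 < PP f 0 S x / PP f 0 t x := div_pos hpS hp
  obtain ⟨l, hl⟩ : ∃ l : ℝ, l = (PP f 0 S x / PP f 0 t x) ^ ((q : ℝ)⁻¹) := ⟨_, rfl⟩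
  have hl0 : 0 < l := hl ▸ Real.rpow_pos_of_pos hR _
  have hlq : l ^ q = PP f 0 S x / PP f 0 t x := by
    rw [hl]; exact Real.rpow_inv_natCast_pow hR.le hq.ne'
  have hyoung : ∀ h : ℝ, 0 ≤ h → l ^ (q - 1) * h ≤ l ^ q + h ^ q := by
    intro h hh
    have e1 : l ^ q = l ^ (q - 1) * l := by rw [← pow_succ, Nat.sub_add_cancel hq]
    have e2 : h ^ q = h ^ (q - 1) * h := by rw [← pow_succ, Nat.sub_add_cancel hq]
    rcases le_total h l with h1 | h1
    · have : l ^ (q - 1) * h ≤ l ^ q := by rw [e1]; exact mul_le_mul_of_nonneg_left h1 (by positivity)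
      have : 0 ≤ h ^ q := by positivity
      linarith
    · have : l ^ (q - 1) * h ≤ h ^ q := by
        rw [e2]; exact mul_le_mul_of_nonneg_right (pow_le_pow_left₀ hl0.le h1 _) hh
      have : 0 ≤ l ^ q := by positivity
      linarith
  have hmain : l ^ (q - 1) * |PP f k t x| ≤ l ^ q * PP f 0 t x + C * PP f 0 S x := by
    have h1 : |PP f k t x| ≤ ∫ y, |f y * KK k t (x - y)| := by
      unfold PP; exact abs_integral_le_integral_abs
    have h2 : l ^ (q - 1) * ∫ y, |f y * KK k t (x - y)| ≤
        ∫ y, (l ^ q * (f y * KK 0 t (x - y)) + f y * (|hk k t (x - y)| ^ q * gK t (x - y))) := by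
      rw [← integral_const_mul]
      refine integral_mono ((int_KK hf hk5 htp x).abs.const_mul _)
        (((int_KK hf (by norm_num) htp x).const_mul _).add (int_hk_pow hf hk5 htp x)) fun y => ?_
      have g0 := gK_pos htp (x - y)
      have k0 : KK 0 t (x - y) = gK t (x - y) := by simp [KK, hk]
      simp only [k0]
      simp only [KK, abs_mul, abs_of_nonneg (hf0 y), abs_of_pos g0]
      have := mul_le_mul_of_nonneg_right (hyoung _ (abs_nonneg (hk k t (x - y))))
        (mul_nonneg (hf0 y) g0.le)
      refine le_trans (le_of_eq ?_) (this.trans (le_of_eq ?_)) <;> ring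
    rw [integral_add ((int_KK hf (by norm_num) htp x).const_mul _) (int_hk_pow hf hk5 htp x),
      integral_const_mul] at h2
    have h3 := hIntB k hk5 t ht x
    have h4 := mul_le_mul_of_nonneg_left h1 (by positivity : 0 ≤ l ^ (q - 1))
    have h5 : (∫ y, f y * KK 0 t (x - y)) = PP f 0 t x := rfl
    rw [h5] at h2
    linarith
  have hSl : PP f 0 S x = l ^ q * PP f 0 t x := by rw [hlq]; field_simp
  have e1 : l ^ q = l ^ (q - 1) * l := by rw [← pow_succ, Nat.sub_add_cancel hq]
  have hfin : |PP f k t x| ≤ (1 + C) * l * PP f 0 t x := by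
    rw [hSl, e1] at hmain
    have : l ^ (q - 1) * |PP f k t x| ≤ l ^ (q - 1) * ((1 + C) * l * PP f 0 t x) := by
      linarith
    exact le_of_mul_le_mul_left this (by positivity)
  rw [← hlq, ← mul_pow, abs_div, abs_of_pos hp]
  refine pow_le_pow_left₀ (by positivity) ?_ q
  rwa [div_le_iff₀ hp]

end P

section C

/-- Tame functions. -/
def Tame (f : ℝ → ℝ) (U : Set ℝ) (S : ℝ) (F : ℝ → ℝ → ℝ) : Prop :=
  (∀ s ∈ U, Continuous (F s)) ∧
    ∀ q : ℕ, ∃ C : ℝ, 0 ≤ C ∧ ∀ s ∈ U, ∀ x, |F s x| ^ q ≤ C * (PP f 0 S x / PP f 0 s x)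

noncomputable def rr (f : ℝ → ℝ) (k : ℕ) (s x : ℝ) : ℝ := PP f k s x / PP f 0 s x

noncomputable def fa (f : ℝ → ℝ) (s x : ℝ) : ℝ := rr f 1 s x
noncomputable def fb (f : ℝ → ℝ) (s x : ℝ) : ℝ := rr f 2 s x + (-1) * (rr f 1 s x * rr f 1 s x)
noncomputable def fc (f : ℝ → ℝ) (s x : ℝ) : ℝ :=
  rr f 3 s x + ((-3) * (rr f 1 s x * rr f 2 s x) + 2 * (rr f 1 s x * (rr f 1 s x * rr f 1 s x)))
noncomputable def fd (f : ℝ → ℝ) (s x : ℝ) : ℝ :=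
  rr f 4 s x + ((-4) * (rr f 1 s x * rr f 3 s x) + ((-3) * (rr f 2 s x * rr f 2 s x) +
    (12 * (rr f 1 s x * (rr f 1 s x * rr f 2 s x)) +
    (-6) * (rr f 1 s x * (rr f 1 s x * (rr f 1 s x * rr f 1 s x))))))

structure Ctx (f : ℝ → ℝ) (t0 t1 S : ℝ) : Prop where
  hf : Integrable f
  hf0 : ∀ x, 0 ≤ f x
  hf1 : (∫ x : ℝ, f x) = 1
  ht0 : 0 < t0
  ht01 : t0 < t1
  h1S : t1 < S

namespace Ctx
variable {f : ℝ → ℝ} {t0 t1 S : ℝ}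

theorem pos (h : Ctx f t0 t1 S) {s : ℝ} (hs : s ∈ Set.Ioo t0 t1) (x : ℝ) : 0 < PP f 0 s x :=
  PP_pos h.hf h.hf0 h.hf1 (h.ht0.trans hs.1) x

theorem posS (h : Ctx f t0 t1 S) (x : ℝ) : 0 < PP f 0 S x :=
  PP_pos h.hf h.hf0 h.hf1 (h.ht0.trans (h.ht01.trans h.h1S)) x

theorem Rpos (h : Ctx f t0 t1 S) {s : ℝ} (hs : s ∈ Set.Ioo t0 t1) (x : ℝ) :
    0 < PP f 0 S x / PP f 0 s x := div_pos (h.posS x) (h.pos hs x)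

theorem one_le (h : Ctx f t0 t1 S) :
    ∃ C : ℝ, 0 ≤ C ∧ ∀ s ∈ Set.Ioo t0 t1, ∀ x, 1 ≤ C * (PP f 0 S x / PP f 0 s x) := by
  obtain ⟨C, h0, hC⟩ := ratio_bound h.hf h.hf0 h.hf1 h.ht0 h.ht01 h.h1S 0
  exact ⟨C, h0, fun s hs x => by simpa using hC 0 (by norm_num) s hs x⟩

theorem rr_dx (h : Ctx f t0 t1 S) {k : ℕ} (hk : k < 4) {s : ℝ} (hs : s ∈ Set.Ioo t0 t1) (x : ℝ) :
    HasDerivAt (rr f k s) (rr f (k + 1) s x - rr f k s x * rr f 1 s x) x := by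
  have hp := (h.pos hs x).ne'
  have hs0 := h.ht0.trans hs.1
  refine ((PP_dx h.hf hk hs0 x).div (PP_dx h.hf (by norm_num : 0 < 4) hs0 x) hp).congr_deriv ?_
  simp only [rr, zero_add]; field_simp

theorem rr_dt (h : Ctx f t0 t1 S) {k : ℕ} (hk : k < 3) {s : ℝ} (hs : s ∈ Set.Ioo t0 t1) (x : ℝ) :
    HasDerivAt (fun s => rr f k s x) ((rr f (k + 2) s x - rr f k s x * rr f 2 s x) / 2) s := by
  have hp := (h.pos hs x).ne'
  have hs0 := h.ht0.trans hs.1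
  refine ((PP_dt h.hf hk hs0 x).div (PP_dt h.hf (by norm_num : 0 < 3) hs0 x) hp).congr_deriv ?_
  simp only [rr, zero_add]; field_simp

theorem PP_cont (h : Ctx f t0 t1 S) {s : ℝ} (hs : 0 < s) {k : ℕ} (hk : k < 5) :
    Continuous (PP f k s) := by
  by_cases hk4 : k < 4
  · exact continuous_iff_continuousAt.2 fun x => (PP_dx h.hf hk4 hs x).continuousAt
  have : k = 4 := by omega
  subst this
  obtain ⟨C, hC⟩ := KK_bdd (t0 := s / 2) (t1 := 2 * s) (by linarith) (by linarith)
  unfold PP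
  refine continuous_of_dominated (bound := fun y => |f y| * C)
    (fun x => (int_KK h.hf hk hs x).aestronglyMeasurable) ?_ (h.hf.abs.mul_const C) ?_
  · refine fun x => Eventually.of_forall fun y => ?_
    rw [norm_mul, Real.norm_eq_abs, Real.norm_eq_abs]
    exact mul_le_mul_of_nonneg_left (hC 4 hk s ⟨by linarith, by linarith⟩ _) (abs_nonneg _)
  · refine Eventually.of_forall fun y => continuous_const.mul ?_
    exact (KK_cont 4 hs).comp (by fun_prop)

theorem rr_tame (h : Ctx f t0 t1 S) {k : ℕ} (hk : k < 5) : Tame f (Set.Ioo t0 t1) S (rr f k) := by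
  refine ⟨fun s hs => ?_, fun q => ?_⟩
  · have hs0 := h.ht0.trans hs.1
    exact (h.PP_cont hs0 hk).div (h.PP_cont hs0 (by norm_num)) fun x => (h.pos hs x).ne'
  · obtain ⟨C, h0, hC⟩ := ratio_bound h.hf h.hf0 h.hf1 h.ht0 h.ht01 h.h1S q
    exact ⟨C, h0, fun s hs x => hC k hk s hs x⟩

theorem tame_const (h : Ctx f t0 t1 S) (c : ℝ) : Tame f (Set.Ioo t0 t1) S (fun _ _ => c) := by
  refine ⟨fun s hs => continuous_const, fun q => ?_⟩
  obtain ⟨C, h0, hC⟩ := h.one_le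
  refine ⟨|c| ^ q * C, by positivity, fun s hs x => ?_⟩
  rw [mul_assoc]
  exact le_mul_of_one_le_right (by positivity) (hC s hs x)

theorem tame_add {F G : ℝ → ℝ → ℝ} {U : Set ℝ} (hF : Tame f U S F) (hG : Tame f U S G) :
    Tame f U S (fun s x => F s x + G s x) := by
  refine ⟨fun s hs => (hF.1 s hs).add (hG.1 s hs), fun q => ?_⟩
  obtain ⟨C, h0, hC⟩ := hF.2 q
  obtain ⟨D, hD0, hD⟩ := hG.2 q
  refine ⟨2 ^ (q - 1) * (C + D), by positivity, fun s hs x => ?_⟩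
  calc |F s x + G s x| ^ q ≤ (|F s x| + |G s x|) ^ q :=
        pow_le_pow_left₀ (abs_nonneg _) (abs_add_le _ _) q
    _ ≤ 2 ^ (q - 1) * (|F s x| ^ q + |G s x| ^ q) :=
        add_pow_le (abs_nonneg _) (abs_nonneg _) q
    _ ≤ 2 ^ (q - 1) * (C * (PP f 0 S x / PP f 0 s x) + D * (PP f 0 S x / PP f 0 s x)) := by
        gcongr
        · exact hC s hs x
        · exact hD s hs x
    _ = _ := by ring

theorem tame_mul {F G : ℝ → ℝ → ℝ} {U : Set ℝ} (hF : Tame f U S F) (hG : Tame f U S G) :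
    Tame f U S (fun s x => F s x * G s x) := by
  refine ⟨fun s hs => (hF.1 s hs).mul (hG.1 s hs), fun q => ?_⟩
  obtain ⟨C, h0, hC⟩ := hF.2 (2 * q)
  obtain ⟨D, hD0, hD⟩ := hG.2 (2 * q)
  refine ⟨C + D, by positivity, fun s hs x => ?_⟩
  have h1 := hC s hs x
  have h2 := hD s hs x
  rw [mul_comm 2 q, pow_mul] at h1 h2
  rw [abs_mul, mul_pow, add_mul]
  nlinarith [sq_nonneg (|F s x| ^ q - |G s x| ^ q), sq_nonneg (|F s x| ^ q), sq_nonneg (|G s x| ^ q)]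

theorem Tfa (h : Ctx f t0 t1 S) : Tame f (Set.Ioo t0 t1) S (fa f) := h.rr_tame (by norm_num)
theorem Tfb (h : Ctx f t0 t1 S) : Tame f (Set.Ioo t0 t1) S (fb f) := by
  unfold fb
  repeat' first
        | exact h.rr_tame (by norm_num) | exact h.tame_const _
        | apply tame_add | apply tame_mul
theorem Tfc (h : Ctx f t0 t1 S) : Tame f (Set.Ioo t0 t1) S (fc f) := by
  unfold fc
  repeat' first
        | exact h.rr_tame (by norm_num) | exact h.tame_const _
        | apply tame_add | apply tame_mul
theorem Tfd (h : Ctx f t0 t1 S) : Tame f (Set.Ioo t0 t1) S (fd f) := by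
  unfold fd
  repeat' first
        | exact h.rr_tame (by norm_num) | exact h.tame_const _
        | apply tame_add | apply tame_mul

theorem setup (h : Ctx f t0 t1 S) {α : ℝ} (hα : 0 < α)
    (hB : Integrable (fun x => PP f 0 S x ^ α)) :
    HeatSetup α (Set.Ioo t0 t1) (fa f) (fb f) (fc f) (fd f) (fun s x => PP f 0 s x ^ α)
      (Tame f (Set.Ioo t0 t1) S) (fun x => PP f 0 S x ^ α) where
  isOpen := isOpen_Ioo
  add := fun F G => tame_add
  mul := fun F G => tame_mul
  const := h.tame_const
  Ta := h.Tfa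
  Tb := h.Tfb
  Tc := h.Tfc
  Td := h.Tfd
  dom := by
    intro F hF
    obtain ⟨q, hq⟩ := exists_nat_gt (1 / α)
    have hq0 : (0:ℝ) < q := lt_trans (by positivity) hq
    have hq1 : q ≠ 0 := by rintro rfl; simp at hq0
    obtain ⟨C, C0, hC⟩ := hF.2 q
    obtain ⟨D, D0, hD⟩ := h.one_le
    refine ⟨(C + D) ^ α, fun s hs x => ?_⟩
    have hR := h.Rpos hs x
    have hp := h.pos hs x
    have h1 : 1 ≤ (C + D) * (PP f 0 S x / PP f 0 s x) :=
      (hD s hs x).trans (mul_le_mul_of_nonneg_right (by linarith) hR.le)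
    have h2 : |F s x| ^ q ≤ (C + D) * (PP f 0 S x / PP f 0 s x) :=
      (hC s hs x).trans (mul_le_mul_of_nonneg_right (by linarith) hR.le)
    have h3 : |F s x| ≤ ((C + D) * (PP f 0 S x / PP f 0 s x)) ^ ((q:ℝ)⁻¹) := by
      have := Real.rpow_le_rpow (by positivity) h2 (by positivity : (0:ℝ) ≤ (q:ℝ)⁻¹)
      rwa [Real.pow_rpow_inv_natCast (abs_nonneg _) hq1] at this
    have h4 : |F s x| ≤ ((C + D) * (PP f 0 S x / PP f 0 s x)) ^ α := by
      refine h3.trans (Real.rpow_le_rpow_of_exponent_le h1 ?_)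
      rw [inv_le_comm₀ hq0 hα, ← one_div]; exact hq.le
    calc |F s x| * PP f 0 s x ^ α ≤ ((C + D) * (PP f 0 S x / PP f 0 s x)) ^ α * PP f 0 s x ^ α :=
          mul_le_mul_of_nonneg_right h4 (by positivity)
      _ = ((C + D) * PP f 0 S x) ^ α := by
          rw [← Real.mul_rpow (by positivity) hp.le]; congr 1; field_simp
      _ = _ := Real.mul_rpow (by positivity) (h.posS x).le
  cont := fun F hF => hF.1
  wpos := fun s hs x => Real.rpow_pos_of_pos (h.pos hs x) _
  wcont := fun s hs => (h.PP_cont (h.ht0.trans hs.1) (by norm_num)).rpow_const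
    fun x => Or.inl (h.pos hs x).ne'
  Bint := hB
  ax := fun s hs x => (h.rr_dx (by norm_num : 1 < 4) hs x).congr_deriv (by simp only [fb]; ring)
  bx := fun s hs x => by
    have d1 := h.rr_dx (by norm_num : 1 < 4) hs x
    have d2 := h.rr_dx (by norm_num : 2 < 4) hs x
    exact (d2.add ((d1.mul d1).const_mul (-1))).congr_deriv (by simp only [fc]; ring)
  cx := fun s hs x => by
    have d1 := h.rr_dx (by norm_num : 1 < 4) hs x
    have d2 := h.rr_dx (by norm_num : 2 < 4) hs x
    have d3 := h.rr_dx (by norm_num : 3 < 4) hs x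
    refine (d3.add (((d1.mul d2).const_mul (-3)).add
      ((d1.mul (d1.mul d1)).const_mul 2))).congr_deriv ?_
    simp only [fd, Pi.mul_apply]; ring
  wx := fun s hs x => by
    have hp := h.pos hs x
    refine ((PP_dx h.hf (by norm_num : 0 < 4) (h.ht0.trans hs.1) x).rpow_const
      (Or.inl hp.ne')).congr_deriv ?_
    simp only [fa, rr, zero_add]
    rw [Real.rpow_sub_one hp.ne']; field_simp
  at' := fun s hs x => (h.rr_dt (by norm_num : 1 < 3) hs x).congr_deriv (by
    simp only [fc, fb, fa]; ring)
  bt := fun s hs x => by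
    have d1 := h.rr_dt (by norm_num : 1 < 3) hs x
    have d2 := h.rr_dt (by norm_num : 2 < 3) hs x
    exact (d2.add ((d1.mul d1).const_mul (-1))).congr_deriv (by simp only [fa, fb, fc, fd]; ring)
  wt := fun s hs x => by
    have hp := h.pos hs x
    refine ((PP_dt h.hf (by norm_num : 0 < 3) (h.ht0.trans hs.1) x).rpow_const
      (Or.inl hp.ne')).congr_deriv ?_
    simp only [fa, fb, rr, zero_add]
    rw [Real.rpow_sub_one hp.ne']; field_simp; ring

end Ctx
end C

section D
open scoped Convolution

theorem gK_eq_pdf {t : ℝ} (ht : 0 < t) : gK t = ProbabilityTheory.gaussianPDFReal 0 ⟨t, ht.le⟩ := by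
  ext z
  simp [gK, ProbabilityTheory.gaussianPDFReal]
  rfl

theorem gK_integrable {t : ℝ} (ht : 0 < t) : Integrable (gK t) := by
  rw [gK_eq_pdf ht]; exact ProbabilityTheory.integrable_gaussianPDFReal _ _

theorem gK_integral {t : ℝ} (ht : 0 < t) : ∫ z, gK t z = 1 := by
  rw [gK_eq_pdf ht]; refine ProbabilityTheory.integral_gaussianPDFReal_eq_one _ ?_
  intro h0; exact ht.ne' (congrArg NNReal.toReal h0)

theorem PP_conv (f : ℝ → ℝ) (t : ℝ) :
    PP f 0 t = f ⋆[ContinuousLinearMap.mul ℝ ℝ, volume] (gK t) := by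
  ext x
  simp [PP, convolution, KK, hk]

theorem PP_integrable {f : ℝ → ℝ} (hf : Integrable f) {t : ℝ} (ht : 0 < t) :
    Integrable (PP f 0 t) := by
  rw [PP_conv]
  exact hf.integrable_convolution _ (gK_integrable ht)

theorem PP_integral {f : ℝ → ℝ} (hf : Integrable f) (hf1 : (∫ x : ℝ, f x) = 1)
    {t : ℝ} (ht : 0 < t) : ∫ x, PP f 0 t x = 1 := by
  rw [PP_conv, integral_convolution _ hf (gK_integrable ht), hf1, gK_integral ht]
  simp

namespace Ctx
variable {f : ℝ → ℝ} {t0 t1 S : ℝ}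

/-- For `α ≠ 1`. -/
theorem renyi_deriv (h : Ctx f t0 t1 S) {α : ℝ} (hα : 0 < α) (hα1 : α ≠ 1)
    (hB : Integrable (fun x => PP f 0 S x ^ α)) {s : ℝ} (hs : s ∈ Set.Ioo t0 t1) :
    HasDerivAt (fun s => renyiEnt f α s)
      (α / 2 * ((∫ x, fa f s x ^ 2 * PP f 0 s x ^ α) / ∫ x, PP f 0 s x ^ α)) s := by
  have st := h.setup hα hB
  have h1 := st.I_deriv hs
  have h2 := st.I_pos hs
  have h3 := (h1.log h2.ne').const_mul (1 - α)⁻¹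
  have e : (fun s => renyiEnt f α s) = fun s => (1 - α)⁻¹ * Real.log (∫ x, PP f 0 s x ^ α) := by
    ext s; simp only [renyiEnt, if_neg hα1, PP_zero]
  rw [e]
  refine h3.congr_deriv ?_
  have : 1 - α ≠ 0 := sub_ne_zero.2 (Ne.symm hα1)
  field_simp

theorem log_bound (h : Ctx f t0 t1 S) :
    ∃ C : ℝ, 0 ≤ C ∧ ∀ s ∈ Set.Ioo t0 t1, ∀ x,
      Real.log (PP f 0 S x / PP f 0 s x) ^ 2 ≤ C * (PP f 0 S x / PP f 0 s x) := by
  obtain ⟨C, C0, hC⟩ := h.one_le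
  refine ⟨4 + C * Real.log C ^ 2, by positivity, fun s hs x => ?_⟩
  have hR := h.Rpos hs x
  have h1 := hC s hs x
  generalize PP f 0 S x / PP f 0 s x = R at *
  rcases le_total 1 R with hR1 | hR1
  · have l0 := Real.log_nonneg hR1
    have l1 : Real.log R ≤ 2 * Real.sqrt R := by
      have := Real.log_le_sub_one_of_pos (Real.sqrt_pos.2 hR)
      rw [Real.log_sqrt hR.le] at this
      linarith
    have l2 : Real.log R ^ 2 ≤ (2 * Real.sqrt R) ^ 2 := pow_le_pow_left₀ l0 l1 2
    rw [mul_pow, Real.sq_sqrt hR.le] at l2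
    have : 0 ≤ C * Real.log C ^ 2 * R := by positivity
    nlinarith
  · have Cp : 0 < C := by
      rcases C0.eq_or_lt with h0 | h0
      · rw [← h0] at h1; linarith
      · exact h0
    have l1 : 0 ≤ Real.log C + Real.log R := by
      rw [← Real.log_mul Cp.ne' hR.ne']; exact Real.log_nonneg h1
    have l2 : Real.log R ≤ 0 := Real.log_nonpos hR.le hR1
    have l3 : Real.log R ^ 2 ≤ Real.log C ^ 2 := by nlinarith
    have : Real.log C ^ 2 ≤ Real.log C ^ 2 * (C * R) :=
      le_mul_of_one_le_right (by positivity) h1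
    nlinarith

theorem dom_log (h : Ctx f t0 t1 S) {F : ℝ → ℝ → ℝ} (hF : Tame f (Set.Ioo t0 t1) S F) :
    ∃ C : ℝ, ∀ s ∈ Set.Ioo t0 t1, ∀ x, |F s x * (PP f 0 s x * Real.log (PP f 0 s x))| ≤
      C * (PP f 0 S x + |PP f 0 S x * Real.log (PP f 0 S x)|) := by
  obtain ⟨C, C0, hC⟩ := hF.2 1
  obtain ⟨D, D0, hD⟩ := hF.2 2
  obtain ⟨E, E0, hE⟩ := h.log_bound
  refine ⟨C + (D + E), fun s hs x => ?_⟩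
  have hp := h.pos hs x
  have hS := h.posS x
  have hR := h.Rpos hs x
  have c1 := hC s hs x
  have c2 := hD s hs x
  have c3 := hE s hs x
  have hlog : Real.log (PP f 0 s x) = Real.log (PP f 0 S x) - Real.log (PP f 0 S x / PP f 0 s x) := by
    rw [Real.log_div hS.ne' hp.ne']; ring
  have hSR : PP f 0 S x = PP f 0 S x / PP f 0 s x * PP f 0 s x := by field_simp
  obtain ⟨R, hRe⟩ : ∃ R, R = PP f 0 S x / PP f 0 s x := ⟨_, rfl⟩
  obtain ⟨L, hL⟩ : ∃ L, L = Real.log (PP f 0 S x) := ⟨_, rfl⟩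
  obtain ⟨M, hM⟩ : ∃ M, M = Real.log R := ⟨_, rfl⟩
  rw [← hRe] at hlog hSR c1 c2 c3 hR
  rw [← hL, ← hM] at hlog
  rw [← hM] at c3
  rw [hlog, ← hL, abs_mul, abs_mul, abs_mul, abs_of_pos hp, abs_of_pos hS]
  rw [pow_one] at c1
  have b1 : |F s x| * |L - M| ≤ C * R * |L| + (D + E) * R := by
    have : |L - M| ≤ |L| + |M| := abs_sub _ _
    have u1 : |F s x| * |L - M| ≤ |F s x| * (|L| + |M|) :=
      mul_le_mul_of_nonneg_left this (abs_nonneg _)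
    have u2 : |F s x| * |L| ≤ C * R * |L| := mul_le_mul_of_nonneg_right c1 (abs_nonneg _)
    rw [← sq_abs] at c3
    nlinarith [sq_nonneg (|F s x| - |M|)]
  have b2 := mul_le_mul_of_nonneg_right b1 hp.le
  have b3 : (C * R * |L| + (D + E) * R) * PP f 0 s x =
      C * (PP f 0 S x * |L|) + (D + E) * PP f 0 S x := by rw [hSR]; ring
  have b4 : 0 ≤ C * PP f 0 S x := by positivity
  have b5 : 0 ≤ (D + E) * (PP f 0 S x * |L|) := by positivity
  nlinarith

theorem int_log (h : Ctx f t0 t1 S)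
    (hB : Integrable (fun x => PP f 0 S x * Real.log (PP f 0 S x)))
    {F : ℝ → ℝ → ℝ} (hF : Tame f (Set.Ioo t0 t1) S F) {s : ℝ} (hs : s ∈ Set.Ioo t0 t1) :
    Integrable (fun x => F s x * (PP f 0 s x * Real.log (PP f 0 s x))) := by
  obtain ⟨C, hC⟩ := h.dom_log hF
  have hc := h.PP_cont (h.ht0.trans hs.1) (by norm_num : 0 < 5)
  refine (((PP_integrable h.hf (h.ht0.trans (h.ht01.trans h.h1S))).add hB.abs).const_mul C).mono'
    ((hF.1 s hs).mul (hc.mul (hc.log fun x => (h.pos hs x).ne'))).aestronglyMeasurable ?_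
  exact Eventually.of_forall fun x => hC s hs x

theorem shannon_deriv (h : Ctx f t0 t1 S)
    (hB : Integrable (fun x => PP f 0 S x * Real.log (PP f 0 S x))) {s : ℝ}
    (hs : s ∈ Set.Ioo t0 t1) :
    HasDerivAt (fun s => renyiEnt f 1 s)
      (1 / 2 * ((∫ x, fa f s x ^ 2 * PP f 0 s x ^ (1:ℝ)) / ∫ x, PP f 0 s x ^ (1:ℝ))) s := by
  have hS0 := h.ht0.trans (h.ht01.trans h.h1S)
  have hs0 := h.ht0.trans hs.1
  have hpS := PP_integrable h.hf hS0
  have st := h.setup one_pos (by simpa using hpS)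
  have T1 := h.rr_tame (by norm_num : 1 < 5)
  have T2 := h.rr_tame (by norm_num : 2 < 5)
  have e : (fun s => renyiEnt f 1 s) = fun s => -∫ x, PP f 0 s x * Real.log (PP f 0 s x) := by
    ext s; simp only [renyiEnt, if_true, PP_zero]
  rw [e]
  simp only [Real.rpow_one, PP_integral h.hf h.hf1 hs0, div_one]
  have i2 : Integrable (fun x => rr f 2 s x * PP f 0 s x) := by
    simpa using st.integrable T2 hs
  have i1 : Integrable (fun x => rr f 1 s x * PP f 0 s x) := by
    simpa using st.integrable T1 hs
  have i11 : Integrable (fun x => rr f 1 s x * rr f 1 s x * PP f 0 s x) := by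
    simpa using st.integrable (tame_mul T1 T1) hs
  have l2 := h.int_log hB T2 hs
  have l1 := h.int_log hB T1 hs
  have hdx : ∀ x, HasDerivAt (PP f 0 s) (rr f 1 s x * PP f 0 s x) x := fun x =>
    (PP_dx h.hf (by norm_num : 0 < 4) hs0 x).congr_deriv (by
      have := (h.pos hs x).ne'
      simp only [rr]; field_simp)
  have hd1 : ∀ x, HasDerivAt (fun x => rr f 1 s x * PP f 0 s x) (rr f 2 s x * PP f 0 s x) x :=
    fun x => ((h.rr_dx (by norm_num : 1 < 4) hs x).mul (hdx x)).congr_deriv (by ring)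
  have z2 : ∫ x, rr f 2 s x * PP f 0 s x = 0 :=
    integral_eq_zero_of_hasDerivAt_of_integrable hd1 i2 i1
  have zl : ∫ x, (rr f 2 s x * (PP f 0 s x * Real.log (PP f 0 s x)) +
      rr f 1 s x * rr f 1 s x * PP f 0 s x) = 0 := by
    refine integral_eq_zero_of_hasDerivAt_of_integrable
      (f := fun x => rr f 1 s x * (PP f 0 s x * Real.log (PP f 0 s x))) (fun x => ?_)
      (l2.add i11) l1
    have hp := (h.pos hs x).ne'
    have := (hd1 x).mul ((hdx x).log hp)
    refine (this.congr_deriv ?_).congr_of_eventuallyEq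
      (Eventually.of_forall fun x => ?_)
    · field_simp
    · simp only [Pi.mul_apply]; ring
  rw [integral_add l2 i11] at zl
  -- time derivative
  obtain ⟨C, hC⟩ := h.dom_log T2
  obtain ⟨D, hD⟩ := st.dom _ T2
  simp only [Real.rpow_one] at hD
  have hU : Set.Ioo t0 t1 ∈ nhds s := isOpen_Ioo.mem_nhds hs
  have dd := (hasDerivAt_integral_of_dominated_loc_of_deriv_le (μ := volume)
    (bound := fun x => (C * (PP f 0 S x + |PP f 0 S x * Real.log (PP f 0 S x)|) +
      D * PP f 0 S x))
    (F := fun s x => PP f 0 s x * Real.log (PP f 0 s x))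
    (F' := fun s x => (rr f 2 s x * (PP f 0 s x * Real.log (PP f 0 s x)) +
      rr f 2 s x * PP f 0 s x) / 2) hU ?_ ?_ ?_ ?_ ?_ ?_).2
  · refine dd.neg.congr_deriv ?_
    rw [integral_div, integral_add l2 i2, z2]
    have : ∫ x, fa f s x ^ 2 * PP f 0 s x = ∫ x, rr f 1 s x * rr f 1 s x * PP f 0 s x := by
      congr 1; ext x; simp only [fa]; ring
    rw [this]
    linarith
  · filter_upwards [hU] with r hr
    have := (h.int_log hB (h.tame_const 1) hr).aestronglyMeasurable
    simpa using this
  · simpa using h.int_log hB (h.tame_const 1) hs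
  · exact ((l2.add i2).div_const 2).aestronglyMeasurable
  · refine Eventually.of_forall fun x r hr => ?_
    have u1 := hC r hr x
    have u2 := hD r hr x
    have hp := h.pos hr x
    rw [norm_div, Real.norm_eq_abs, Real.norm_eq_abs, abs_two]
    have u3 := abs_add_le (rr f 2 r x * (PP f 0 r x * Real.log (PP f 0 r x))) (rr f 2 r x * PP f 0 r x)
    rw [abs_mul (rr f 2 r x) (PP f 0 r x), abs_of_pos hp] at u3
    have u4 : 0 ≤ |rr f 2 r x * (PP f 0 r x * Real.log (PP f 0 r x))| := abs_nonneg _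
    have u5 : 0 ≤ |rr f 2 r x| * PP f 0 r x := by positivity
    linarith
  · exact ((hpS.add hB.abs).const_mul C).add (hpS.const_mul D)
  · refine Eventually.of_forall fun x r hr => ?_
    have hp := (h.pos hr x).ne'
    have d0 := PP_dt h.hf (by norm_num : 0 < 3) (h.ht0.trans hr.1) x
    refine (d0.mul (d0.log hp)).congr_deriv ?_
    simp only [rr, zero_add]; field_simp

end Ctx
end D

/-- Nonnegativity of the third-order derivative of the Rényi entropy along the heat flow,
for orders α ∈ [β₀, 1.76] where β₀ is the unique real root of 9x³ - 12x² + 29x - 10. -/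
theorem renyi_third_derivative_nonneg
    (f : ℝ → ℝ) (hfm : Measurable f) (hf0 : ∀ x, 0 ≤ f x)
    (hf1 : (∫ x : ℝ, f x) = 1)
    (β₀ : ℝ) (hβ₀ : 9 * β₀ ^ 3 - 12 * β₀ ^ 2 + 29 * β₀ - 10 = 0)
    (α : ℝ) (hαl : β₀ ≤ α) (hαu : α ≤ 1.76)
    (t : ℝ) (ht : 0 < t) (htα : ltTalpha f α t) :
    0 ≤ iteratedDeriv 3 (fun s => renyiEnt f α s) t := by
  have hf : Integrable f := by
    by_contra hn
    rw [integral_undef hn] at hf1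
    exact zero_ne_one hf1
  have hβ0 : 0 < β₀ := by
    by_contra hn
    push Not at hn
    nlinarith [sq_nonneg β₀, mul_nonneg (neg_nonneg.2 hn) (sq_nonneg β₀)]
  have hα0 : 0 < α := hβ0.trans_le hαl
  have hαc : 0 ≤ 9 * α ^ 3 - 12 * α ^ 2 + 29 * α - 10 := by
    have e : 9 * α ^ 3 - 12 * α ^ 2 + 29 * α - 10 = (α - β₀) *
        (9 * (α ^ 2 + α * β₀ + β₀ ^ 2) - 12 * (α + β₀) + 29) := by linear_combination hβ₀
    rw [e]
    refine mul_nonneg (sub_nonneg.2 hαl) ?_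
    nlinarith [sq_nonneg (α + β₀ - 1), sq_nonneg (α - β₀), sq_nonneg (α + β₀)]
  obtain ⟨S, htS, hS0, hfin⟩ := htα
  have h : Ctx f (t / 2) ((t + S) / 2) S :=
    ⟨hf, hf0, hf1, by linarith, by linarith, by linarith⟩
  have htU : t ∈ Set.Ioo (t / 2) ((t + S) / 2) := ⟨by linarith, by linarith⟩
  obtain ⟨hB, hd⟩ : Integrable (fun x => PP f 0 S x ^ α) ∧
      ∀ s ∈ Set.Ioo (t / 2) ((t + S) / 2), HasDerivAt (fun s => renyiEnt f α s)
      (α / 2 * ((∫ x, fa f s x ^ 2 * PP f 0 s x ^ α) / ∫ x, PP f 0 s x ^ α)) s := by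
    by_cases hα1 : α = 1
    · subst hα1
      simp only [renyiFinite, if_true] at hfin
      refine ⟨by simpa using PP_integrable hf hS0, fun s hs => h.shannon_deriv ?_ hs⟩
      simpa only [PP_zero] using hfin
    · simp only [renyiFinite, if_neg hα1] at hfin
      have hB : Integrable (fun x => PP f 0 S x ^ α) := by simpa only [PP_zero] using hfin.1
      exact ⟨hB, fun s hs => h.renyi_deriv hα0 hα1 hB hs⟩
  have st := h.setup hα0 hB
  have hm := st.main hαc hα0 hαu htU
  have hev : deriv (fun s => renyiEnt f α s) =ᶠ[nhds t]
      fun s => α / 2 * ((∫ x, fa f s x ^ 2 * PP f 0 s x ^ α) / ∫ x, PP f 0 s x ^ α) := by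
    filter_upwards [isOpen_Ioo.mem_nhds htU] with s hs using (hd s hs).deriv
  rw [iteratedDeriv_succ', hev.iteratedDeriv_eq 2, iteratedDeriv_const_mul_field]
  exact mul_nonneg (by linarith) hm
end

section
/- For every α ∈ (0,∞) and every t ∈ (0, t_α): (i) d/dt E_α[p̄₁⁶] = (5/14)(α-6)(α-7) E_α[p̄₁⁸] − 15 E_α[p̄₁⁴p̄₂²] + (α(α-1)/2) E_α[p̄₁⁶] E_α[p̄₁²]; (ii) d/dt E_α[p̄₁²p̄₂²] = ((α-4)(α-5)/2) E_α[p̄₁⁴p̄₂²] + (7/3)(α-4) E_α[p̄₁²p̄₂³] + (1/3) E_α[p̄₂⁴] − E_α[p̄₁²p̄₃²] + (α(α-1)/2) E_α[p̄₁²] E_α[p̄₁²p̄₂²]; (iii) d/dt E_α[p̄₂³] = ((α-3)(α-4)/2) E_α[p̄₁²p̄₂³] + (α-3) E_α[p̄₂⁴] − 3 E_α[p̄₂p̄₃²] + (α(α-1)/2) E_α[p̄₂³] E_α[p̄₁²]; (iv) d/dt E_α[p̄₃²] = ((α-2)(α-3)/2) E_α[p̄₁²p̄₃²] + (α-2) E_α[p̄₂p̄₃²]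 − E_α[p̄₄²] + (α(α-1)/2) E_α[p̄₁²] E_α[p̄₃²]. -/
open MeasureTheory Real Filter
open scoped Classical

namespace HeatAux

/-- Monomials of a sequence, normalised to be homogeneous of degree `α`. -/
noncomputable def Mo (α : ℝ) (v : ℕ → ℝ) (l : List ℕ) : ℝ :=
  (l.map v).prod * v 0 ^ (α - l.length)

/-- All lists obtained by increasing one entry by `j`. -/
def shifts (j : ℕ) : List ℕ → List (List ℕ)
  | [] => []
  | k :: l => ((k + j) :: l) :: (shifts j l).map (fun l' => k :: l')

lemma length_of_mem_shifts (j : ℕ) (l : List ℕ) : ∀ l' ∈ shifts j l, l'.length = l.length := by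
  induction l with
  | nil => simp [shifts]
  | cons k l ih =>
    intro l' h
    simp only [shifts, List.mem_cons, List.mem_map] at h
    rcases h with h | ⟨m, hm, rfl⟩
    · simp [h]
    · simp [ih m hm]

/-- The formal derivative of a monomial. -/
noncomputable def DM (α : ℝ) (v : ℕ → ℝ) (j : ℕ) (l : List ℕ) : ℝ :=
  ((shifts j l).map (Mo α v)).sum + (α - l.length) * Mo α v (j :: l)

lemma hasDerivAt_prod (v : ℕ → ℝ → ℝ) (c : ℝ) (j : ℕ) (s : ℝ)
    (h : ∀ k, HasDerivAt (v k) (c * v (k + j) s) s) (l : List ℕ) :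
    HasDerivAt (fun r => (l.map (fun k => v k r)).prod)
      (c * ((shifts j l).map (fun l' => (l'.map (fun k => v k s)).prod)).sum) s := by
  induction l with
  | nil => simpa [shifts] using hasDerivAt_const s (1 : ℝ)
  | cons k l ih =>
    have := (h k).mul ih
    simp only [List.map_cons, List.prod_cons, shifts, List.sum_cons, List.map_map]
    refine this.congr_deriv ?_
    have : ((fun l' : List ℕ => (l'.map (fun k => v k s)).prod) ∘ fun l' => k :: l')
        = fun l' => v k s * (l'.map (fun k => v k s)).prod := by
      funext l'; simp
    rw [this, List.sum_map_mul_left]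
    ring

lemma hasDerivAt_Mo (α : ℝ) (v : ℕ → ℝ → ℝ) (c : ℝ) (j : ℕ) (s : ℝ)
    (h : ∀ k, HasDerivAt (v k) (c * v (k + j) s) s) (hp : 0 < v 0 s) (l : List ℕ) :
    HasDerivAt (fun r => Mo α (fun k => v k r) l) (c * DM α (fun k => v k s) j l) s := by
  unfold Mo
  have h1 := hasDerivAt_prod v c j s h l
  have h2 := (h 0).rpow_const (p := α - l.length) (Or.inl hp.ne')
  refine (h1.mul h2).congr_deriv ?_
  unfold DM
  have : (shifts j l).map (Mo α (fun k => v k s)) = (shifts j l).map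
      (fun l' => (l'.map (fun k => v k s)).prod * v 0 s ^ (α - l.length)) := by
    apply List.map_congr_left
    intro l' hl'
    simp [Mo, length_of_mem_shifts j l l' hl']
  rw [this, List.sum_map_mul_right]
  simp only [Mo, List.map_cons, List.prod_cons, List.length_cons, zero_add]
  push_cast
  rw [show α - ((l.length : ℝ) + 1) = α - l.length - 1 by ring]
  ring

lemma Mo_eq (α : ℝ) (v : ℕ → ℝ) (hp : 0 < v 0) (l : List ℕ) :
    Mo α v l = (l.map (fun k => v k / v 0)).prod * v 0 ^ α := by
  have : (l.map (fun k => v k / v 0)).prod = (l.map v).prod / v 0 ^ l.length := by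
    induction l with
    | nil => simp
    | cons k l ih => simp [ih, pow_succ]; field_simp
  rw [this, Mo, Real.rpow_sub hp, Real.rpow_natCast]; field_simp

/-- Hermite-type factors. -/
noncomputable def H : ℕ → ℝ → ℝ → ℝ
  | 0, _, _ => 1
  | 1, t, z => -(z / t)
  | (k + 2), t, z => -(z / t) * H (k + 1) t z - ((k + 1 : ℕ) : ℝ) / t * H k t z

/-- Gaussian kernel. -/
noncomputable def G (t z : ℝ) : ℝ := (Real.sqrt (2 * Real.pi * t))⁻¹ * Real.exp (-z ^ 2 / (2 * t))

lemma G_pos {t : ℝ} (ht : 0 < t) (z : ℝ) : 0 < G t z := by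
  unfold G; positivity

lemma hasDerivAt_H_z (t : ℝ) (ht : 0 < t) (z : ℝ) (k : ℕ) :
    HasDerivAt (fun z => H k t z) (H (k + 1) t z + z / t * H k t z) z := by
  induction k using Nat.twoStepInduction with
  | zero => simpa [H] using hasDerivAt_const z (1 : ℝ)
  | one =>
    have : HasDerivAt (fun z : ℝ => -(z / t)) (-(1 / t)) z := ((hasDerivAt_id z).div_const t).neg
    simp only [H]
    refine this.congr_deriv ?_
    push_cast; field_simp; ring
  | more k h0 h1 =>
    have hz : HasDerivAt (fun z : ℝ => -(z / t)) (-(1 / t)) z := ((hasDerivAt_id z).div_const t).neg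
    have := (hz.mul h1).sub (h0.const_mul (((k + 1 : ℕ) : ℝ) / t))
    simp only [H] at this ⊢
    refine this.congr_deriv ?_
    push_cast; field_simp; ring

lemma hasDerivAt_H_t (t : ℝ) (ht : 0 < t) (z : ℝ) (k : ℕ) :
    HasDerivAt (fun t => H k t z)
      (1 / 2 * H (k + 2) t z - (z ^ 2 / (2 * t ^ 2) - 1 / (2 * t)) * H k t z) t := by
  have hz : HasDerivAt (fun t : ℝ => -(z / t)) (z / t ^ 2) t := by
    have := ((hasDerivAt_inv ht.ne').const_mul z).neg
    simp only [div_eq_mul_inv]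
    exact this.congr_deriv (by ring)
  induction k using Nat.twoStepInduction with
  | zero =>
    simp only [H]
    refine (hasDerivAt_const t (1 : ℝ)).congr_deriv ?_
    push_cast; field_simp; ring
  | one =>
    simp only [H]
    refine hz.congr_deriv ?_
    push_cast; field_simp; ring
  | more k h0 h1 =>
    have hk : HasDerivAt (fun t : ℝ => ((k + 1 : ℕ) : ℝ) / t) (-((k + 1 : ℕ) : ℝ) / t ^ 2) t := by
      have := ((hasDerivAt_inv ht.ne').const_mul ((k + 1 : ℕ) : ℝ))
      simp only [div_eq_mul_inv]
      exact this.congr_deriv (by ring)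
    have := (hz.mul h1).sub (hk.mul h0)
    simp only [H] at this ⊢
    refine this.congr_deriv ?_
    push_cast; field_simp; ring

lemma hasDerivAt_G_z (t : ℝ) (ht : 0 < t) (z : ℝ) : HasDerivAt (G t) (-(z / t) * G t z) z := by
  unfold G
  have : HasDerivAt (fun z : ℝ => -z ^ 2 / (2 * t)) (-(z / t)) z := by
    refine (((hasDerivAt_pow 2 z).neg).div_const (2 * t)).congr_deriv ?_
    simp; field_simp
  exact (this.exp.const_mul _).congr_deriv (by ring)

lemma hasDerivAt_G_t (t : ℝ) (ht : 0 < t) (z : ℝ) :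
    HasDerivAt (fun t => G t z) ((z ^ 2 / (2 * t ^ 2) - 1 / (2 * t)) * G t z) t := by
  unfold G
  have h1 : HasDerivAt (fun t : ℝ => -z ^ 2 / (2 * t)) (z ^ 2 / (2 * t ^ 2)) t := by
    have := ((hasDerivAt_id t).const_mul 2).inv (by simp [ht.ne'])
    have := this.const_mul (-z ^ 2)
    simp only [div_eq_mul_inv]
    refine this.congr_deriv ?_
    simp; field_simp
  have hpos : 0 < 2 * Real.pi * t := by positivity
  have h2 : HasDerivAt (fun t : ℝ => (Real.sqrt (2 * Real.pi * t))⁻¹)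
      (-(1 / (2 * t)) * (Real.sqrt (2 * Real.pi * t))⁻¹) t := by
    have := (((hasDerivAt_id t).const_mul (2 * Real.pi)).sqrt (by simpa using hpos.ne')).inv
      (by simpa using (Real.sqrt_pos.2 hpos).ne')
    refine this.congr_deriv ?_
    have hs := Real.sq_sqrt hpos.le
    have hs0 := (Real.sqrt_pos.2 hpos).ne'
    simp only [id]
    rw [hs]
    field_simp
  exact (h2.mul h1.exp).congr_deriv (by ring)

lemma hasDerivAt_HG_z (t : ℝ) (ht : 0 < t) (z : ℝ) (k : ℕ) :
    HasDerivAt (fun z => H k t z * G t z) (H (k + 1) t z * G t z) z :=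
  ((hasDerivAt_H_z t ht z k).mul (hasDerivAt_G_z t ht z)).congr_deriv (by ring)

lemma hasDerivAt_HG_t (t : ℝ) (ht : 0 < t) (z : ℝ) (k : ℕ) :
    HasDerivAt (fun t => H k t z * G t z) (1 / 2 * (H (k + 2) t z * G t z)) t :=
  ((hasDerivAt_H_t t ht z k).mul (hasDerivAt_G_t t ht z)).congr_deriv (by ring)

lemma H_bound (a : ℝ) (ha : 0 < a) (k : ℕ) : ∀ ε : ℝ, 0 < ε → ∃ C : ℝ, 0 ≤ C ∧ ∀ t, a ≤ t → ∀ z,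
    |H k t z| ≤ C * Real.exp (ε * z ^ 2) := by
  have key : ∀ ε : ℝ, 0 < ε → ∃ K : ℝ, 0 ≤ K ∧ ∀ t, a ≤ t → ∀ z,
      |z / t| ≤ K * Real.exp (ε * z ^ 2) := by
    intro ε hε
    refine ⟨(1 / ε + 1) / a, by positivity, fun t ht z => ?_⟩
    have htp : 0 < t := ha.trans_le ht
    rw [abs_div, abs_of_pos htp]
    have h1 : |z| ≤ 1 + z ^ 2 := by
      rw [← sq_abs]; nlinarith [sq_nonneg (|z| - 1), abs_nonneg z]
    have h2 := Real.add_one_le_exp (ε * z ^ 2)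
    have h4 : 1 ≤ Real.exp (ε * z ^ 2) := Real.one_le_exp (by positivity)
    have h3 : |z| ≤ (1 / ε + 1) * Real.exp (ε * z ^ 2) := by
      have : z ^ 2 ≤ 1 / ε * Real.exp (ε * z ^ 2) := by
        rw [one_div, inv_mul_eq_div, le_div_iff₀ hε]; linarith
      linarith
    calc |z| / t ≤ |z| / a := by gcongr
      _ ≤ ((1 / ε + 1) * Real.exp (ε * z ^ 2)) / a := by gcongr
      _ = _ := by ring
  induction k using Nat.twoStepInduction with
  | zero =>
    intro ε hε
    refine ⟨1, by norm_num, fun t ht z => ?_⟩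
    simp only [H, abs_one, one_mul]
    exact Real.one_le_exp (by positivity)
  | one =>
    intro ε hε
    obtain ⟨K, hK, h⟩ := key ε hε
    refine ⟨K, hK, fun t ht z => ?_⟩
    simp only [H, abs_neg]
    exact h t ht z
  | more k h0 h1 =>
    intro ε hε
    obtain ⟨K, hK, h⟩ := key (ε / 2) (by positivity)
    obtain ⟨C1, hC1, h1⟩ := h1 (ε / 2) (by positivity)
    obtain ⟨C0, hC0, h0⟩ := h0 ε hε
    refine ⟨K * C1 + (k + 1 : ℕ) / a * C0, by positivity, fun t ht z => ?_⟩
    have htp : 0 < t := ha.trans_le ht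
    simp only [H]
    have e : Real.exp (ε * z ^ 2) = Real.exp (ε / 2 * z ^ 2) * Real.exp (ε / 2 * z ^ 2) := by
      rw [← Real.exp_add]; congr 1; ring
    calc |-(z / t) * H (k + 1) t z - ((k + 1 : ℕ) : ℝ) / t * H k t z|
        ≤ |-(z / t) * H (k + 1) t z| + |((k + 1 : ℕ) : ℝ) / t * H k t z| := abs_sub _ _
      _ = |z / t| * |H (k + 1) t z| + ((k + 1 : ℕ) : ℝ) / t * |H k t z| := by
          rw [abs_mul, abs_mul, abs_neg, abs_of_nonneg (a := ((k + 1 : ℕ) : ℝ) / t) (by positivity)]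
      _ ≤ (K * Real.exp (ε / 2 * z ^ 2)) * (C1 * Real.exp (ε / 2 * z ^ 2))
          + ((k + 1 : ℕ) : ℝ) / a * (C0 * Real.exp (ε * z ^ 2)) := by
          gcongr
          · exact h t ht z
          · exact h1 t ht z
          · exact h0 t ht z
      _ = _ := by rw [e]; ring

lemma HG_bound (a b s : ℝ) (ha : 0 < a) (hab : a ≤ b) (hbs : b < s) (k r : ℕ) (hr : 0 < r) :
    ∃ C : ℝ, 0 ≤ C ∧ ∀ t, a ≤ t → t ≤ b → ∀ z, |H k t z| ^ r * G t z ≤ C * G s z := by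
  have hb : 0 < b := ha.trans_le hab
  have hs : 0 < s := hb.trans hbs
  have hr' : (0 : ℝ) < r := by exact_mod_cast hr
  have hpos : 0 < 1 / (2 * b) - 1 / (2 * s) := by
    rw [sub_pos]; apply one_div_lt_one_div_of_lt <;> linarith
  obtain ⟨C, hC, h⟩ := H_bound a ha k ((1 / (2 * b) - 1 / (2 * s)) / r) (by positivity)
  refine ⟨C ^ r * ((Real.sqrt (2 * Real.pi * a))⁻¹ * Real.sqrt (2 * Real.pi * s)), by positivity,
    fun t hat htb z => ?_⟩
  have ht : 0 < t := ha.trans_le hat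
  have hsq : 0 < Real.sqrt (2 * Real.pi * s) := Real.sqrt_pos.2 (by positivity)
  have hG : G t z ≤ (Real.sqrt (2 * Real.pi * a))⁻¹ * Real.exp (-(1 / (2 * b)) * z ^ 2) := by
    unfold G
    have : -z ^ 2 / (2 * t) ≤ -(1 / (2 * b)) * z ^ 2 := by
      have : z ^ 2 / (2 * b) ≤ z ^ 2 / (2 * t) := by gcongr
      have e1 : -z ^ 2 / (2 * t) = -(z ^ 2 / (2 * t)) := by ring
      have e2 : -(1 / (2 * b)) * z ^ 2 = -(z ^ 2 / (2 * b)) := by ring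
      rw [e1, e2]; linarith
    gcongr
  calc |H k t z| ^ r * G t z
      ≤ (C * Real.exp ((1 / (2 * b) - 1 / (2 * s)) / r * z ^ 2)) ^ r
        * ((Real.sqrt (2 * Real.pi * a))⁻¹ * Real.exp (-(1 / (2 * b)) * z ^ 2)) := by
        gcongr
        · exact (G_pos ht z).le
        · exact h t hat z
    _ = C ^ r * (Real.sqrt (2 * Real.pi * a))⁻¹ * Real.exp (-z ^ 2 / (2 * s)) := by
        rw [mul_pow, ← Real.exp_nat_mul]
        have : Real.exp (-z ^ 2 / (2 * s)) = Real.exp (r * ((1 / (2 * b) - 1 / (2 * s)) / r * z ^ 2))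
            * Real.exp (-(1 / (2 * b)) * z ^ 2) := by
          rw [← Real.exp_add]; congr 1; field_simp; ring
        rw [this]; ring
    _ = _ := by
        unfold G
        have := hsq.ne'
        field_simp

/-- Derivatives of the heat flow. -/
noncomputable def u (f : ℝ → ℝ) (k : ℕ) (t x : ℝ) : ℝ := ∫ y : ℝ, f y * (H k t (x - y) * G t (x - y))

lemma u_zero (f : ℝ → ℝ) (t x : ℝ) : u f 0 t x = heatP f t x := by
  simp [u, heatP, H, G]

lemma continuous_HG (k : ℕ) {t : ℝ} (ht : 0 < t) : Continuous (fun z => H k t z * G t z) :=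
  continuous_iff_continuousAt.2 fun z => (hasDerivAt_HG_z t ht z k).continuousAt

lemma HG_bdd (a b : ℝ) (ha : 0 < a) (hab : a ≤ b) (k : ℕ) :
    ∃ C : ℝ, 0 ≤ C ∧ ∀ t, a ≤ t → t ≤ b → ∀ z, |H k t z * G t z| ≤ C := by
  obtain ⟨C, hC, h⟩ := HG_bound a b (b + 1) ha hab (by linarith) k 1 one_pos
  have hb : 0 < b + 1 := by linarith
  refine ⟨C * (Real.sqrt (2 * Real.pi * (b + 1)))⁻¹, by positivity, fun t hat htb z => ?_⟩
  rw [abs_mul, abs_of_pos (G_pos (ha.trans_le hat) z)]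
  have := h t hat htb z
  rw [pow_one] at this
  refine this.trans ?_
  have : G (b + 1) z ≤ (Real.sqrt (2 * Real.pi * (b + 1)))⁻¹ := by
    unfold G
    apply mul_le_of_le_one_right (by positivity)
    rw [Real.exp_le_one_iff]
    rw [neg_div]
    have : 0 ≤ z ^ 2 / (2 * (b + 1)) := by positivity
    linarith
  gcongr


lemma integrable_u {f : ℝ → ℝ} (hfi : Integrable f) (k : ℕ) {t : ℝ} (ht : 0 < t) (x : ℝ) :
    Integrable (fun y => f y * (H k t (x - y) * G t (x - y))) := by
  obtain ⟨C, hC, h⟩ := HG_bdd t t ht le_rfl k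
  refine hfi.mul_bdd (c := C) ?_ ?_
  · exact ((continuous_HG k ht).comp (continuous_const.sub continuous_id)).aestronglyMeasurable
  · exact Eventually.of_forall fun y => h t le_rfl le_rfl _

lemma hasDerivAt_u_x {f : ℝ → ℝ} (hfi : Integrable f) (k : ℕ) {t : ℝ} (ht : 0 < t) (x : ℝ) :
    HasDerivAt (fun x => u f k t x) (u f (k + 1) t x) x := by
  obtain ⟨C, hC, h⟩ := HG_bdd t t ht le_rfl (k + 1)
  refine (hasDerivAt_integral_of_dominated_loc_of_deriv_le (s := Set.univ)
    (F := fun x y => f y * (H k t (x - y) * G t (x - y)))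
    (F' := fun x y => f y * (H (k + 1) t (x - y) * G t (x - y)))
    (bound := fun y => |f y| * C) Filter.univ_mem ?_ ?_ ?_ ?_ ?_ ?_).2
  · exact Eventually.of_forall fun x => (integrable_u hfi k ht x).aestronglyMeasurable
  · exact integrable_u hfi k ht x
  · exact (integrable_u hfi (k + 1) ht x).aestronglyMeasurable
  · refine Eventually.of_forall fun y x _ => ?_
    rw [Real.norm_eq_abs, abs_mul]
    gcongr
    exact h t le_rfl le_rfl _
  · exact hfi.abs.mul_const C
  · refine Eventually.of_forall fun y x _ => ?_
    have := (hasDerivAt_HG_z t ht (x - y) k).comp_sub_const x y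
    exact this.const_mul (f y)

lemma hasDerivAt_u_t {f : ℝ → ℝ} (hfi : Integrable f) (k : ℕ) {t : ℝ} (ht : 0 < t) (x : ℝ) :
    HasDerivAt (fun t => u f k t x) (1 / 2 * u f (k + 2) t x) t := by
  obtain ⟨C, hC, h⟩ := HG_bdd (t / 2) (2 * t) (by positivity) (by linarith) (k + 2)
  have key := (hasDerivAt_integral_of_dominated_loc_of_deriv_le (s := Set.Icc (t / 2) (2 * t))
    (μ := volume) (x₀ := t)
    (F := fun t y => f y * (H k t (x - y) * G t (x - y)))
    (F' := fun t y => 1 / 2 * (f y * (H (k + 2) t (x - y) * G t (x - y))))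
    (bound := fun y => 1 / 2 * (|f y| * C)) (Icc_mem_nhds (by linarith) (by linarith))
      ?_ ?_ ?_ ?_ ?_ ?_).2
  · rw [integral_const_mul] at key
    exact key
  · filter_upwards [lt_mem_nhds ht] with s hs
    exact (integrable_u hfi k hs x).aestronglyMeasurable
  · exact integrable_u hfi k ht x
  · exact ((integrable_u hfi (k + 2) ht x).const_mul _).aestronglyMeasurable
  · refine Eventually.of_forall fun y s hs => ?_
    rw [Real.norm_eq_abs, abs_mul, abs_mul, abs_of_pos (by norm_num : (0 : ℝ) < 1 / 2)]
    gcongr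
    exact h s hs.1 hs.2 _
  · exact (hfi.abs.mul_const C).const_mul _
  · refine Eventually.of_forall fun y s hs => ?_
    have hs0 : 0 < s := lt_of_lt_of_le (by positivity) hs.1
    exact ((hasDerivAt_HG_t s hs0 (x - y) k).const_mul (f y)).congr_deriv (by ring)

lemma pk_eq {f : ℝ → ℝ} (hfi : Integrable f) (k : ℕ) {t : ℝ} (ht : 0 < t) (x : ℝ) : pk f k t x = u f k t x := by
  unfold pk
  induction k generalizing x with
  | zero => rw [iteratedDeriv_zero, u_zero]
  | succ k ih =>
    rw [iteratedDeriv_succ, show iteratedDeriv k (heatP f t) = u f k t from funext ih]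
    exact (hasDerivAt_u_x hfi k ht x).deriv


lemma u_bound_aux {f : ℝ → ℝ} (hfi : Integrable f) (hf0 : ∀ x, 0 ≤ f x)
    (a b s : ℝ) (ha : 0 < a) (hab : a ≤ b) (hbs : b < s) (k r : ℕ) (hr : 0 < r) :
    ∃ C : ℝ, 0 ≤ C ∧ ∀ t, a ≤ t → t ≤ b → ∀ x θ, 0 < θ →
      |u f k t x| ≤ θ * u f 0 t x + C * (θ / θ ^ r) * u f 0 s x := by
  obtain ⟨C, hC, h⟩ := HG_bound a b s ha hab hbs k r hr
  refine ⟨C, hC, fun t hat htb x θ hθ => ?_⟩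
  have ht : 0 < t := ha.trans_le hat
  have hs : 0 < s := by linarith
  have i0 := integrable_u hfi 0 ht x
  have i1 := integrable_u hfi 0 hs x
  have ik := integrable_u hfi k ht x
  unfold u
  rw [← integral_const_mul, ← integral_const_mul, ← integral_add (i0.const_mul _) (i1.const_mul _)]
  refine (abs_integral_le_integral_abs).trans ?_
  refine integral_mono ik.abs ((i0.const_mul _).add (i1.const_mul _)) fun y => ?_
  simp only [H, one_mul]
  have hG := G_pos ht (x - y)
  rw [abs_mul, abs_mul, abs_of_pos hG, abs_of_nonneg (hf0 y)]
  have hb := h t hat htb (x - y)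
  have key : |H k t (x - y)| ≤ θ + (θ / θ ^ r) * |H k t (x - y)| ^ r := by
    set w := |H k t (x - y)| with hw
    have hw0 : 0 ≤ w := abs_nonneg _
    rcases le_total w θ with hle | hle
    · have : 0 ≤ θ / θ ^ r * w ^ r := by positivity
      linarith
    · obtain ⟨m, rfl⟩ : ∃ m, r = m + 1 := ⟨r - 1, by omega⟩
      have : w ≤ θ / θ ^ (m + 1) * w ^ (m + 1) := by
        have e : θ / θ ^ (m + 1) * w ^ (m + 1) = w * (w / θ) ^ m := by
          rw [div_pow]; field_simp; ring
        rw [e]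
        apply le_mul_of_one_le_right hw0
        apply one_le_pow₀
        rwa [one_le_div hθ]
      linarith
  calc f y * (|H k t (x - y)| * G t (x - y))
      ≤ f y * ((θ + (θ / θ ^ r) * |H k t (x - y)| ^ r) * G t (x - y)) := by
        gcongr
        exact hf0 y
    _ = θ * (f y * G t (x - y)) + (θ / θ ^ r) * f y * (|H k t (x - y)| ^ r * G t (x - y)) := by ring
    _ ≤ θ * (f y * G t (x - y)) + (θ / θ ^ r) * f y * (C * G s (x - y)) := by
        have := hf0 y
        gcongr
    _ = _ := by ring

lemma u_mono_aux {f : ℝ → ℝ} (hfi : Integrable f) (hf0 : ∀ x, 0 ≤ f x)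
    (a b s : ℝ) (ha : 0 < a) (hab : a ≤ b) (hbs : b < s) :
    ∃ K : ℝ, 0 < K ∧ ∀ t, a ≤ t → t ≤ b → ∀ x, u f 0 t x ≤ K * u f 0 s x := by
  obtain ⟨C, hC, h⟩ := HG_bound a b s ha hab hbs 0 1 one_pos
  refine ⟨C + 1, by positivity, fun t hat htb x => ?_⟩
  have ht : 0 < t := ha.trans_le hat
  have hs : 0 < s := by linarith
  have i0 := integrable_u hfi 0 ht x
  have i1 := integrable_u hfi 0 hs x
  unfold u
  rw [← integral_const_mul]
  refine integral_mono i0 (i1.const_mul _) fun y => ?_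
  have := h t hat htb (x - y)
  simp only [H, one_mul, pow_one, abs_one] at this ⊢
  have hG := G_pos hs (x - y)
  have hf := hf0 y
  calc f y * G t (x - y) ≤ f y * (C * G s (x - y)) := by gcongr
    _ ≤ (C + 1) * (f y * G s (x - y)) := by nlinarith [mul_nonneg hf hG.le]


lemma u_pos {f : ℝ → ℝ} (hfi : Integrable f) (hf0 : ∀ x, 0 ≤ f x) (hf1 : (∫ x : ℝ, f x) = 1)
    {t : ℝ} (ht : 0 < t) (x : ℝ) : 0 < u f 0 t x := by
  have i0 := integrable_u hfi 0 ht x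
  have e : (fun y => f y * (H 0 t (x - y) * G t (x - y))) = fun y => f y * G t (x - y) := by
    simp [H]
  unfold u
  rw [e] at i0 ⊢
  rw [integral_pos_iff_support_of_nonneg (fun y => mul_nonneg (hf0 y) (G_pos ht _).le) i0]
  have h1 : 0 < ∫ x, f x := by rw [hf1]; norm_num
  rw [integral_pos_iff_support_of_nonneg hf0 hfi] at h1
  convert h1 using 2
  ext y
  simp [(G_pos ht (x - y)).ne']

lemma ubar_bound {f : ℝ → ℝ} (hfi : Integrable f) (hf0 : ∀ x, 0 ≤ f x) (hf1 : (∫ x : ℝ, f x) = 1)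
    (a b s : ℝ) (ha : 0 < a) (hab : a ≤ b) (hbs : b < s) (k r : ℕ) (hr : 0 < r) :
    ∃ C : ℝ, 0 ≤ C ∧ ∀ t, a ≤ t → t ≤ b → ∀ x,
      |u f k t x / u f 0 t x| ≤ C * (u f 0 s x / u f 0 t x) ^ ((r : ℝ)⁻¹) := by
  obtain ⟨C, hC, h⟩ := u_bound_aux hfi hf0 a b s ha hab hbs k r hr
  refine ⟨1 + C, by positivity, fun t hat htb x => ?_⟩
  have ht : 0 < t := ha.trans_le hat
  have hs : 0 < s := by linarith
  have hp := u_pos hfi hf0 hf1 ht x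
  have hq := u_pos hfi hf0 hf1 hs x
  set θ := (u f 0 s x / u f 0 t x) ^ ((r : ℝ)⁻¹) with hθ
  have hθ0 : 0 < θ := by positivity
  have hθr : θ ^ r = u f 0 s x / u f 0 t x := by
    rw [hθ, ← Real.rpow_natCast, ← Real.rpow_mul (by positivity), inv_mul_cancel₀ (by positivity),
      Real.rpow_one]
  have := h t hat htb x θ hθ0
  rw [hθr] at this
  rw [abs_div, abs_of_pos hp, div_le_iff₀ hp]
  refine this.trans (le_of_eq ?_)
  field_simp

lemma Mo_bound {f : ℝ → ℝ} (hfi : Integrable f) (hf0 : ∀ x, 0 ≤ f x) (hf1 : (∫ x : ℝ, f x) = 1)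
    (α : ℝ) (hα : 0 < α) (a b s : ℝ) (ha : 0 < a) (hab : a ≤ b) (hbs : b < s) (l : List ℕ) :
    ∃ C : ℝ, 0 ≤ C ∧ ∀ t, a ≤ t → t ≤ b → ∀ x,
      |Mo α (fun k => u f k t x) l| ≤ C * u f 0 s x ^ α := by
  obtain ⟨K, hK, hmono⟩ := u_mono_aux hfi hf0 a b s ha hab hbs
  obtain ⟨r, hr⟩ := exists_nat_gt ((l.length : ℝ) / α)
  have hr0 : (0 : ℝ) < r := lt_of_le_of_lt (by positivity) hr
  have hr1 : 0 < r := by exact_mod_cast hr0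
  have hmr : (l.length : ℝ) / r ≤ α := by
    rw [div_lt_iff₀ hα] at hr
    rw [div_le_iff₀ hr0]; linarith
  have hprod : ∃ C : ℝ, 0 ≤ C ∧ ∀ t, a ≤ t → t ≤ b → ∀ x,
      |(l.map (fun k => u f k t x / u f 0 t x)).prod|
        ≤ C * ((u f 0 s x / u f 0 t x) ^ ((r : ℝ)⁻¹)) ^ l.length := by
    clear hmr hr
    induction l with
    | nil => exact ⟨1, by norm_num, fun t _ _ x => by simp⟩
    | cons k l ih =>
      obtain ⟨C, hC, h⟩ := ih
      obtain ⟨C', hC', h'⟩ := ubar_bound hfi hf0 hf1 a b s ha hab hbs k r hr1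
      refine ⟨C' * C, by positivity, fun t hat htb x => ?_⟩
      rw [List.map_cons, List.prod_cons, abs_mul, List.length_cons, pow_succ]
      have ht : 0 < t := ha.trans_le hat
      have hs : 0 < s := by linarith
      have hp := u_pos hfi hf0 hf1 ht x
      have hq := u_pos hfi hf0 hf1 hs x
      calc _ ≤ (C' * (u f 0 s x / u f 0 t x) ^ ((r : ℝ)⁻¹))
            * (C * ((u f 0 s x / u f 0 t x) ^ ((r : ℝ)⁻¹)) ^ l.length) := by
              gcongr
              · exact h' t hat htb x
              · exact h t hat htb x
        _ = _ := by ring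
  obtain ⟨C, hC, h⟩ := hprod
  refine ⟨C * K ^ (α - l.length / r), by positivity, fun t hat htb x => ?_⟩
  have ht : 0 < t := ha.trans_le hat
  have hs : 0 < s := by linarith
  have hp := u_pos hfi hf0 hf1 ht x
  have hq := u_pos hfi hf0 hf1 hs x
  rw [Mo_eq α (fun k => u f k t x) hp l, abs_mul, abs_of_pos (Real.rpow_pos_of_pos hp α)]
  have e1 : ((u f 0 s x / u f 0 t x) ^ ((r : ℝ)⁻¹)) ^ l.length
      = u f 0 s x ^ ((l.length : ℝ) / r) / u f 0 t x ^ ((l.length : ℝ) / r) := by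
    rw [← Real.rpow_natCast, ← Real.rpow_mul (by positivity), Real.div_rpow hq.le hp.le]
    rw [inv_mul_eq_div]
  have e2 : u f 0 t x ^ α = u f 0 t x ^ ((l.length : ℝ) / r) * u f 0 t x ^ (α - (l.length : ℝ) / r) := by
    rw [← Real.rpow_add hp]; congr 1; ring
  have e3 : u f 0 s x ^ α = u f 0 s x ^ ((l.length : ℝ) / r) * u f 0 s x ^ (α - (l.length : ℝ) / r) := by
    rw [← Real.rpow_add hq]; congr 1; ring
  have h3 : u f 0 t x ^ (α - (l.length : ℝ) / r)
      ≤ K ^ (α - (l.length : ℝ) / r) * u f 0 s x ^ (α - (l.length : ℝ) / r) := by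
    rw [← Real.mul_rpow hK.le hq.le]
    exact Real.rpow_le_rpow hp.le (hmono t hat htb x) (by linarith)
  have hpp := Real.rpow_pos_of_pos hp ((l.length : ℝ) / r)
  calc _ ≤ (C * (u f 0 s x ^ ((l.length : ℝ) / r) / u f 0 t x ^ ((l.length : ℝ) / r))) *
        (u f 0 t x ^ ((l.length : ℝ) / r) * u f 0 t x ^ (α - (l.length : ℝ) / r)) := by
        rw [← e1, ← e2]
        gcongr
        exact h t hat htb x
    _ = C * u f 0 s x ^ ((l.length : ℝ) / r) * u f 0 t x ^ (α - (l.length : ℝ) / r) := by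
        field_simp
    _ ≤ C * u f 0 s x ^ ((l.length : ℝ) / r) *
        (K ^ (α - (l.length : ℝ) / r) * u f 0 s x ^ (α - (l.length : ℝ) / r)) := by
        gcongr
    _ = _ := by rw [e3]; ring

lemma DM_bound {f : ℝ → ℝ} (hfi : Integrable f) (hf0 : ∀ x, 0 ≤ f x) (hf1 : (∫ x : ℝ, f x) = 1)
    (α : ℝ) (hα : 0 < α) (a b s : ℝ) (ha : 0 < a) (hab : a ≤ b) (hbs : b < s) (j : ℕ)
    (l : List ℕ) :
    ∃ C : ℝ, 0 ≤ C ∧ ∀ t, a ≤ t → t ≤ b → ∀ x,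
      |DM α (fun k => u f k t x) j l| ≤ C * u f 0 s x ^ α := by
  have hL : ∀ L : List (List ℕ), ∃ C : ℝ, 0 ≤ C ∧ ∀ t, a ≤ t → t ≤ b → ∀ x,
      |(L.map (Mo α (fun k => u f k t x))).sum| ≤ C * u f 0 s x ^ α := by
    intro L
    induction L with
    | nil => exact ⟨0, le_rfl, fun t _ _ x => by simp⟩
    | cons l L ih =>
      obtain ⟨C, hC, h⟩ := ih
      obtain ⟨C', hC', h'⟩ := Mo_bound hfi hf0 hf1 α hα a b s ha hab hbs l
      refine ⟨C' + C, by positivity, fun t hat htb x => ?_⟩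
      rw [List.map_cons, List.sum_cons]
      refine (abs_add_le _ _).trans ?_
      rw [add_mul]
      exact add_le_add (h' t hat htb x) (h t hat htb x)
  obtain ⟨C, hC, h⟩ := hL (shifts j l)
  obtain ⟨C', hC', h'⟩ := Mo_bound hfi hf0 hf1 α hα a b s ha hab hbs (j :: l)
  refine ⟨C + |α - l.length| * C', by positivity, fun t hat htb x => ?_⟩
  unfold DM
  refine (abs_add_le _ _).trans ?_
  rw [add_mul, abs_mul, mul_assoc]
  exact add_le_add (h t hat htb x) (mul_le_mul_of_nonneg_left (h' t hat htb x) (abs_nonneg _))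

lemma continuous_Mo {f : ℝ → ℝ} (hfi : Integrable f) (hf0 : ∀ x, 0 ≤ f x) (hf1 : (∫ x : ℝ, f x) = 1)
    (α : ℝ) {t : ℝ} (ht : 0 < t) (l : List ℕ) :
    Continuous (fun x => Mo α (fun k => u f k t x) l) := by
  refine continuous_iff_continuousAt.2 fun x => ?_
  exact (hasDerivAt_Mo α (fun k x => u f k t x) 1 1 x
    (fun k => by simpa using hasDerivAt_u_x hfi k ht x) (u_pos hfi hf0 hf1 ht x) l).continuousAt

/-- Integral of a monomial. -/
noncomputable def J (f : ℝ → ℝ) (α : ℝ) (l : List ℕ) (t : ℝ) : ℝ :=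
  ∫ x, Mo α (fun k => u f k t x) l

lemma integrable_heat {f : ℝ → ℝ} (hfi : Integrable f) {s : ℝ} (hs : 0 < s) : Integrable (fun x => u f 0 s x) := by
  have hG : Integrable (fun z => G s z) := by
    unfold G
    have := (integrable_exp_neg_mul_sq (b := 1 / (2 * s)) (by positivity)).const_mul
      (Real.sqrt (2 * Real.pi * s))⁻¹
    refine this.congr (Eventually.of_forall fun z => ?_)
    simp only
    congr 2; ring
  have := hfi.integrable_convolution (ContinuousLinearMap.mul ℝ ℝ) hG
  refine this.congr (Eventually.of_forall fun x => ?_)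
  rw [convolution_def]
  simp [u, H]

lemma integrable_rpow {f : ℝ → ℝ} (hfi : Integrable f) (hf0 : ∀ x, 0 ≤ f x) (hf1 : (∫ x : ℝ, f x) = 1)
    (α : ℝ) {s : ℝ} (hs : 0 < s) (h : renyiFinite f α s) :
    Integrable (fun x => u f 0 s x ^ α) := by
  unfold renyiFinite at h
  split_ifs at h with h1
  · subst h1
    simpa using integrable_heat hfi hs
  · simpa [u_zero] using h.1


lemma integrable_Mo {f : ℝ → ℝ} (hfi : Integrable f) (hf0 : ∀ x, 0 ≤ f x) (hf1 : (∫ x : ℝ, f x) = 1)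
    {α : ℝ} (hα : 0 < α) {t : ℝ} (ht : 0 < t) (htα : ltTalpha f α t)
    (l : List ℕ) : Integrable (fun x => Mo α (fun k => u f k t x) l) := by
  obtain ⟨s, hts, hs, hfin⟩ := htα
  obtain ⟨C, hC, h⟩ := Mo_bound hfi hf0 hf1 α hα t t s ht le_rfl hts l
  refine ((integrable_rpow hfi hf0 hf1 α hs hfin).const_mul C).mono'
    (continuous_Mo hfi hf0 hf1 α ht l).aestronglyMeasurable ?_
  exact Eventually.of_forall fun x => h t le_rfl le_rfl x

lemma integral_list {f : ℝ → ℝ} (hfi : Integrable f) (hf0 : ∀ x, 0 ≤ f x) (hf1 : (∫ x : ℝ, f x) = 1)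
    {α : ℝ} (hα : 0 < α) {t : ℝ} (ht : 0 < t) (htα : ltTalpha f α t)
    (L : List (List ℕ)) :
    Integrable (fun x => (L.map (Mo α (fun k => u f k t x))).sum) ∧
    ∫ x, (L.map (Mo α (fun k => u f k t x))).sum = (L.map (fun l => J f α l t)).sum := by
  induction L with
  | nil => simp
  | cons l L ih =>
    have i1 := integrable_Mo hfi hf0 hf1 hα ht htα l
    simp only [List.map_cons, List.sum_cons]
    refine ⟨i1.add ih.1, ?_⟩
    rw [integral_add i1 ih.1, ih.2, J]

lemma integral_DM {f : ℝ → ℝ} (hfi : Integrable f) (hf0 : ∀ x, 0 ≤ f x) (hf1 : (∫ x : ℝ, f x) = 1)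
    {α : ℝ} (hα : 0 < α) {t : ℝ} (ht : 0 < t) (htα : ltTalpha f α t)
    (j : ℕ) (l : List ℕ) :
    Integrable (fun x => DM α (fun k => u f k t x) j l) ∧
    ∫ x, DM α (fun k => u f k t x) j l
      = ((shifts j l).map (fun l => J f α l t)).sum + (α - l.length) * J f α (j :: l) t := by
  have h1 := integral_list hfi hf0 hf1 hα ht htα (shifts j l)
  have h2 := (integrable_Mo hfi hf0 hf1 hα ht htα (j :: l)).const_mul (α - l.length)
  unfold DM
  refine ⟨h1.1.add h2, ?_⟩
  rw [integral_add h1.1 h2, h1.2, integral_const_mul, J]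

/-- Integration by parts. -/
lemma ibp {f : ℝ → ℝ} (hfi : Integrable f) (hf0 : ∀ x, 0 ≤ f x) (hf1 : (∫ x : ℝ, f x) = 1)
    {α : ℝ} (hα : 0 < α) {t : ℝ} (ht : 0 < t) (htα : ltTalpha f α t)
    (l : List ℕ) :
    ((shifts 1 l).map (fun l => J f α l t)).sum + (α - l.length) * J f α (1 :: l) t = 0 := by
  have h := integral_DM hfi hf0 hf1 hα ht htα 1 l
  rw [← h.2]
  refine integral_eq_zero_of_hasDerivAt_of_integrable (fun x => ?_) h.1
    (integrable_Mo hfi hf0 hf1 hα ht htα l)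
  simpa using hasDerivAt_Mo α (fun k x => u f k t x) 1 1 x
    (fun k => by simpa using hasDerivAt_u_x hfi k ht x) (u_pos hfi hf0 hf1 ht x) l

/-- Time derivative. -/
lemma hasDerivAt_J {f : ℝ → ℝ} (hfi : Integrable f) (hf0 : ∀ x, 0 ≤ f x) (hf1 : (∫ x : ℝ, f x) = 1)
    {α : ℝ} (hα : 0 < α) {t : ℝ} (ht : 0 < t) (htα : ltTalpha f α t)
    (l : List ℕ) :
    HasDerivAt (fun t => J f α l t)
     (1 / 2 * (((shifts 2 l).map (fun l => J f α l t)).sum + (α - l.length) * J f α (2 :: l) t)) t := by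
  have hI := integral_DM hfi hf0 hf1 hα ht htα 2 l
  have iM := integrable_Mo hfi hf0 hf1 hα ht htα l
  obtain ⟨s, hts, hs, hfin⟩ := htα
  obtain ⟨C, hC, h⟩ := DM_bound hfi hf0 hf1 α hα (t / 2) ((t + s) / 2) s (by positivity)
    (by linarith) (by linarith) 2 l
  have key := (hasDerivAt_integral_of_dominated_loc_of_deriv_le
    (s := Set.Icc (t / 2) ((t + s) / 2)) (μ := volume) (x₀ := t)
    (F := fun t x => Mo α (fun k => u f k t x) l)
    (F' := fun t x => 1 / 2 * DM α (fun k => u f k t x) 2 l)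
    (bound := fun x => 1 / 2 * (C * u f 0 s x ^ α)) (Icc_mem_nhds (by linarith) (by linarith))
      ?_ iM ?_ ?_ ?_ ?_).2
  · rw [integral_const_mul, hI.2] at key
    exact key
  · filter_upwards [lt_mem_nhds ht] with r hr
    exact (continuous_Mo hfi hf0 hf1 α hr l).aestronglyMeasurable
  · exact (hI.1.const_mul _).aestronglyMeasurable
  · refine Eventually.of_forall fun x r hr => ?_
    rw [Real.norm_eq_abs, abs_mul, abs_of_pos (by norm_num : (0 : ℝ) < 1 / 2)]
    gcongr
    exact h r hr.1 hr.2 x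
  · exact ((integrable_rpow hfi hf0 hf1 α hs hfin).const_mul C).const_mul _
  · refine Eventually.of_forall fun x r hr => ?_
    have hr0 : 0 < r := lt_of_lt_of_le (by positivity) hr.1
    exact hasDerivAt_Mo α (fun k r => u f k r x) (1 / 2) 2 r
      (fun k => hasDerivAt_u_t hfi k hr0 x) (u_pos hfi hf0 hf1 hr0 x) l

lemma J_nil_pos {f : ℝ → ℝ} (hfi : Integrable f) (hf0 : ∀ x, 0 ≤ f x) (hf1 : (∫ x : ℝ, f x) = 1)
    {α : ℝ} (hα : 0 < α) {t : ℝ} (ht : 0 < t) (htα : ltTalpha f α t)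
    : 0 < J f α [] t := by
  have i := integrable_Mo hfi hf0 hf1 hα ht htα []
  have hpos : ∀ x, 0 < Mo α (fun k => u f k t x) [] := fun x => by
    simpa [Mo] using Real.rpow_pos_of_pos (u_pos hfi hf0 hf1 ht x) α
  unfold J
  rw [integral_pos_iff_support_of_nonneg (fun x => (hpos x).le) i]
  have : Function.support (fun x => Mo α (fun k => u f k t x) []) = Set.univ := by
    ext x; simp [(hpos x).ne']
  rw [this]; simp

lemma Ea_eq {f : ℝ → ℝ} (hfi : Integrable f) (hf0 : ∀ x, 0 ≤ f x) (hf1 : (∫ x : ℝ, f x) = 1)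
    {α : ℝ} {t : ℝ} (ht : 0 < t)
    (l : List ℕ) :
    Ea f α t (fun x => (l.map (fun k => pbar f k t x)).prod) = J f α l t / J f α [] t := by
  unfold Ea J
  have : ∀ l : List ℕ, ∀ x, Mo α (fun k => u f k t x) l
      = (l.map (fun k => pbar f k t x)).prod * heatP f t x ^ α := by
    intro l x
    rw [Mo_eq α (fun k => u f k t x) (u_pos hfi hf0 hf1 ht x) l]
    simp only [pbar, pk_eq hfi _ ht, u_zero]
  simp only [this]
  simp

lemma hasDerivAt_Ea {f : ℝ → ℝ} (hfi : Integrable f) (hf0 : ∀ x, 0 ≤ f x) (hf1 : (∫ x : ℝ, f x) = 1)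
    {α : ℝ} (hα : 0 < α) {t : ℝ} (ht : 0 < t) (htα : ltTalpha f α t)
    (l : List ℕ) :
    HasDerivAt (fun s => Ea f α s (fun x => (l.map (fun k => pbar f k s x)).prod))
     (1 / 2 * (((shifts 2 l).map (fun l => J f α l t)).sum + (α - l.length) * J f α (2 :: l) t)
        / J f α [] t
       + α * (α - 1) / 2 * (J f α l t / J f α [] t) * (J f α [1, 1] t / J f α [] t)) t := by
  have h1 := hasDerivAt_J hfi hf0 hf1 hα ht htα l
  have h2 := hasDerivAt_J hfi hf0 hf1 hα ht htα []
  have hp := J_nil_pos hfi hf0 hf1 hα ht htα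
  have hi := ibp hfi hf0 hf1 hα ht htα [1]
  simp [shifts] at h2 hi
  have hi' : J f α [2] t = -((α - 1) * J f α [1, 1] t) := by linarith
  have := (h1.div h2 hp.ne').congr_of_eventuallyEq
    (f₁ := fun s => Ea f α s (fun x => (l.map (fun k => pbar f k s x)).prod)) (by
      filter_upwards [lt_mem_nhds ht] with s hs
      exact Ea_eq hfi hf0 hf1 hs l)
  refine this.congr_deriv ?_
  rw [hi']
  field_simp
  ring

lemma J_perm (f : ℝ → ℝ) (α t : ℝ) {l l' : List ℕ} (h : l.Perm l') : J f α l t = J f α l' t := by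
  unfold J Mo
  congr 1; funext x
  rw [h.length_eq, (h.map _).prod_eq]

end HeatAux

/-- Time derivatives of the tilted expectations E_α[p̄₁⁶], E_α[p̄₁²p̄₂²], E_α[p̄₂³],
and E_α[p̄₃²] along the heat flow. -/
theorem deriv_of_tilted_expectations_fourth
    (f : ℝ → ℝ) (hfm : Measurable f) (hf0 : ∀ x, 0 ≤ f x)
    (hf1 : (∫ x : ℝ, f x) = 1)
    (α : ℝ) (hα : 0 < α)
    (t : ℝ) (ht : 0 < t) (htα : ltTalpha f α t) :
    HasDerivAt (fun s => Ea f α s (fun x => (pbar f 1 s x) ^ 6))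
      (5 / 14 * (α - 6) * (α - 7) * Ea f α t (fun x => (pbar f 1 t x) ^ 8)
        - 15 * Ea f α t (fun x => (pbar f 1 t x) ^ 4 * (pbar f 2 t x) ^ 2)
        + α * (α - 1) / 2 * Ea f α t (fun x => (pbar f 1 t x) ^ 6)
            * Ea f α t (fun x => (pbar f 1 t x) ^ 2)) t
    ∧ HasDerivAt (fun s => Ea f α s (fun x => (pbar f 1 s x) ^ 2 * (pbar f 2 s x) ^ 2))
      ((α - 4) * (α - 5) / 2 * Ea f α t (fun x => (pbar f 1 t x) ^ 4 * (pbar f 2 t x) ^ 2)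
        + 7 / 3 * (α - 4) * Ea f α t (fun x => (pbar f 1 t x) ^ 2 * (pbar f 2 t x) ^ 3)
        + 1 / 3 * Ea f α t (fun x => (pbar f 2 t x) ^ 4)
        - Ea f α t (fun x => (pbar f 1 t x) ^ 2 * (pbar f 3 t x) ^ 2)
        + α * (α - 1) / 2 * Ea f α t (fun x => (pbar f 1 t x) ^ 2)
            * Ea f α t (fun x => (pbar f 1 t x) ^ 2 * (pbar f 2 t x) ^ 2)) t
    ∧ HasDerivAt (fun s => Ea f α s (fun x => (pbar f 2 s x) ^ 3))
      ((α - 3) * (α - 4) / 2 * Ea f α t (fun x => (pbar f 1 t x) ^ 2 * (pbar f 2 t x) ^ 3)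
        + (α - 3) * Ea f α t (fun x => (pbar f 2 t x) ^ 4)
        - 3 * Ea f α t (fun x => pbar f 2 t x * (pbar f 3 t x) ^ 2)
        + α * (α - 1) / 2 * Ea f α t (fun x => (pbar f 2 t x) ^ 3)
            * Ea f α t (fun x => (pbar f 1 t x) ^ 2)) t
    ∧ HasDerivAt (fun s => Ea f α s (fun x => (pbar f 3 s x) ^ 2))
      ((α - 2) * (α - 3) / 2 * Ea f α t (fun x => (pbar f 1 t x) ^ 2 * (pbar f 3 t x) ^ 2)
        + (α - 2) * Ea f α t (fun x => pbar f 2 t x * (pbar f 3 t x) ^ 2)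
        - Ea f α t (fun x => (pbar f 4 t x) ^ 2)
        + α * (α - 1) / 2 * Ea f α t (fun x => (pbar f 1 t x) ^ 2)
            * Ea f α t (fun x => (pbar f 3 t x) ^ 2)) t := by
  have hfi : Integrable f := by
    by_contra h
    rw [integral_undef h] at hf1
    norm_num at hf1
  have hp := HeatAux.J_nil_pos hfi hf0 hf1 hα ht htα
  have E : ∀ (l : List ℕ) (g : ℝ → ℝ), (∀ x, g x = (l.map (fun k => pbar f k t x)).prod) →
      Ea f α t g = HeatAux.J f α l t / HeatAux.J f α [] t := by
    intro l g hg
    rw [show g = fun x => (l.map (fun k => pbar f k t x)).prod from funext hg]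
    exact HeatAux.Ea_eq hfi hf0 hf1 ht l
  have D := fun l => HeatAux.hasDerivAt_Ea hfi hf0 hf1 hα ht htα l
  have I := fun l => HeatAux.ibp hfi hf0 hf1 hα ht htα l
  have Pm := fun (l l' : List ℕ) (h : l.Perm l') => HeatAux.J_perm f α t h
  have E11 := E [1, 1] (fun x => (pbar f 1 t x) ^ 2)
    (fun x => by simp only [List.map_cons, List.map_nil, List.prod_cons, List.prod_nil]; ring)
  have E16 := E [1, 1, 1, 1, 1, 1] (fun x => (pbar f 1 t x) ^ 6)
    (fun x => by simp only [List.map_cons, List.map_nil, List.prod_cons, List.prod_nil]; ring)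
  have E18 := E [1, 1, 1, 1, 1, 1, 1, 1] (fun x => (pbar f 1 t x) ^ 8)
    (fun x => by simp only [List.map_cons, List.map_nil, List.prod_cons, List.prod_nil]; ring)
  have E1422 := E [1, 1, 1, 1, 2, 2] (fun x => (pbar f 1 t x) ^ 4 * (pbar f 2 t x) ^ 2)
    (fun x => by simp only [List.map_cons, List.map_nil, List.prod_cons, List.prod_nil]; ring)
  have E1222 := E [1, 1, 2, 2] (fun x => (pbar f 1 t x) ^ 2 * (pbar f 2 t x) ^ 2)
    (fun x => by simp only [List.map_cons, List.map_nil, List.prod_cons, List.prod_nil]; ring)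
  have E1223 := E [1, 1, 2, 2, 2] (fun x => (pbar f 1 t x) ^ 2 * (pbar f 2 t x) ^ 3)
    (fun x => by simp only [List.map_cons, List.map_nil, List.prod_cons, List.prod_nil]; ring)
  have E23 := E [2, 2, 2] (fun x => (pbar f 2 t x) ^ 3)
    (fun x => by simp only [List.map_cons, List.map_nil, List.prod_cons, List.prod_nil]; ring)
  have E24 := E [2, 2, 2, 2] (fun x => (pbar f 2 t x) ^ 4)
    (fun x => by simp only [List.map_cons, List.map_nil, List.prod_cons, List.prod_nil]; ring)
  have E1232 := E [1, 1, 3, 3] (fun x => (pbar f 1 t x) ^ 2 * (pbar f 3 t x) ^ 2)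
    (fun x => by simp only [List.map_cons, List.map_nil, List.prod_cons, List.prod_nil]; ring)
  have E232 := E [2, 3, 3] (fun x => pbar f 2 t x * (pbar f 3 t x) ^ 2)
    (fun x => by simp only [List.map_cons, List.map_nil, List.prod_cons, List.prod_nil]; ring)
  have E32 := E [3, 3] (fun x => (pbar f 3 t x) ^ 2)
    (fun x => by simp only [List.map_cons, List.map_nil, List.prod_cons, List.prod_nil]; ring)
  have E42 := E [4, 4] (fun x => (pbar f 4 t x) ^ 2)
    (fun x => by simp only [List.map_cons, List.map_nil, List.prod_cons, List.prod_nil]; ring)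
  rw [E11, E16, E18, E1422, E1222, E1223, E23, E24, E1232, E232, E32, E42]
  -- integrations by parts shared by (ii) and (iii)
  have IA := I [1, 2, 2, 2]
  simp only [HeatAux.shifts, List.map_cons, List.map_nil, List.sum_cons, List.sum_nil,
    List.length_cons, List.length_nil] at IA
  rw [Pm [1, 2 + 1, 2, 2] [1, 2, 2, 3] (by decide), Pm [1, 2, 2 + 1, 2] [1, 2, 2, 3] (by decide)]
    at IA
  norm_num at IA
  refine ⟨?_, ?_, ?_, ?_⟩
  · have d := D [1, 1, 1, 1, 1, 1]
    have I1 := I [1, 1, 1, 1, 1, 2]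
    have I2 := I [1, 1, 1, 1, 1, 1, 1]
    simp only [HeatAux.shifts, List.map_cons, List.map_nil, List.sum_cons, List.sum_nil,
      List.length_cons, List.length_nil, List.prod_cons, List.prod_nil] at d I1 I2
    norm_num at d I1 I2
    simp only [Pm [3, 1, 1, 1, 1, 1] [1, 1, 1, 1, 1, 3] (by decide),
      Pm [1, 3, 1, 1, 1, 1] [1, 1, 1, 1, 1, 3] (by decide),
      Pm [1, 1, 3, 1, 1, 1] [1, 1, 1, 1, 1, 3] (by decide),
      Pm [1, 1, 1, 3, 1, 1] [1, 1, 1, 1, 1, 3] (by decide),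
      Pm [1, 1, 1, 1, 3, 1] [1, 1, 1, 1, 1, 3] (by decide),
      Pm [2, 1, 1, 1, 1, 1, 1] [1, 1, 1, 1, 1, 1, 2] (by decide),
      Pm [2, 1, 1, 1, 1, 2] [1, 1, 1, 1, 2, 2] (by decide),
      Pm [1, 2, 1, 1, 1, 2] [1, 1, 1, 1, 2, 2] (by decide),
      Pm [1, 1, 2, 1, 1, 2] [1, 1, 1, 1, 2, 2] (by decide),
      Pm [1, 1, 1, 2, 1, 2] [1, 1, 1, 1, 2, 2] (by decide),
      Pm [1, 2, 1, 1, 1, 1, 1] [1, 1, 1, 1, 1, 1, 2] (by decide),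
      Pm [1, 1, 2, 1, 1, 1, 1] [1, 1, 1, 1, 1, 1, 2] (by decide),
      Pm [1, 1, 1, 2, 1, 1, 1] [1, 1, 1, 1, 1, 1, 2] (by decide),
      Pm [1, 1, 1, 1, 2, 1, 1] [1, 1, 1, 1, 1, 1, 2] (by decide),
      Pm [1, 1, 1, 1, 1, 2, 1] [1, 1, 1, 1, 1, 1, 2] (by decide)] at d I1 I2
    convert d using 1
    · funext s; congr 1; funext x; ring
    · linear_combination -3 / HeatAux.J f α [] t * I1 + 5 / 14 * (α - 6) / HeatAux.J f α [] t * I2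
  · have d := D [1, 1, 2, 2]
    have I1 := I [1, 1, 2, 3]
    have I2 := I [1, 1, 1, 2, 2]
    simp only [HeatAux.shifts, List.map_cons, List.map_nil, List.sum_cons, List.sum_nil,
      List.length_cons, List.length_nil, List.prod_cons, List.prod_nil] at d I1 I2
    norm_num at d I1 I2
    simp only [Pm [3, 1, 2, 2] [1, 2, 2, 3] (by decide),
      Pm [1, 3, 2, 2] [1, 2, 2, 3] (by decide),
      Pm [1, 1, 4, 2] [1, 1, 2, 4] (by decide),
      Pm [2, 1, 1, 2, 2] [1, 1, 2, 2, 2] (by decide),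
      Pm [2, 1, 2, 3] [1, 2, 2, 3] (by decide),
      Pm [1, 2, 1, 2, 2] [1, 1, 2, 2, 2] (by decide),
      Pm [1, 1, 1, 3, 2] [1, 1, 1, 2, 3] (by decide)] at d I1 I2
    convert d using 1
    · funext s; congr 1; funext x; ring
    · linear_combination -1 / HeatAux.J f α [] t * I1 + (α - 4) / 2 / HeatAux.J f α [] t * I2 + 1 / 3 / HeatAux.J f α [] t * IA
  · have d := D [2, 2, 2]
    have I1 := I [2, 2, 3]
    simp only [HeatAux.shifts, List.map_cons, List.map_nil, List.sum_cons, List.sum_nil,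
      List.length_cons, List.length_nil, List.prod_cons, List.prod_nil] at d I1
    norm_num at d I1
    simp only [Pm [4, 2, 2] [2, 2, 4] (by decide),
      Pm [2, 4, 2] [2, 2, 4] (by decide),
      Pm [3, 2, 3] [2, 3, 3] (by decide)] at d I1
    convert d using 1
    · funext s; congr 1; funext x; ring
    · linear_combination -3 / 2 / HeatAux.J f α [] t * I1 + (α - 3) / 2 / HeatAux.J f α [] t * IA
  · have d := D [3, 3]
    have I1 := I [3, 4]
    have I2 := I [1, 3, 3]
    simp only [HeatAux.shifts, List.map_cons, List.map_nil, List.sum_cons, List.sum_nil,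
      List.length_cons, List.length_nil, List.prod_cons, List.prod_nil] at d I1 I2
    norm_num at d I1 I2
    simp only [Pm [5, 3] [3, 5] (by decide),
      Pm [1, 4, 3] [1, 3, 4] (by decide)] at d I1 I2
    convert d using 1
    · funext s; congr 1; funext x; ring
    · linear_combination -1 / HeatAux.J f α [] t * I1 + (α - 2) / 2 / HeatAux.J f α [] t * I2
end
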